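/- arXiv:math/9902133 — 3 statements merged into one kernel-verified Lean document; each statement's English description precedes it below -/
import Mathlib

section
/- Let A be an affine (finitely generated) prime P.I. algebra over an algebraically closed field k of characteristic 0. Then p.i.deg A = sup_M p.i.deg(A/M), where M runs through the set of all maximal two-sided ideals of A. -/
open scoped BigOperators

/-- `p` is a polynomial identity of the ring `A`. -/
def IsPolyIdentity (A : Type) [Ring A] (p : FreeAlgebra ℤ ℕ) : Prop :=
  ∀ f : ℕ → A, FreeAlgebra.lift ℤ f p = 0

/-- `A` has degree at most `d`: it satisfies all polynomial identities of `d × d`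
matrices over commutative rings. -/
def DegLE (A : Type) [Ring A] (d : ℕ) : Prop :=
  ∀ p : FreeAlgebra ℤ ℕ,
    (∀ (R : Type) [CommRing R], IsPolyIdentity (Matrix (Fin d) (Fin d) R) p) →
    IsPolyIdentity A p

/-- `deg A = d`. -/
def HasDeg (A : Type) [Ring A] (d : ℕ) : Prop :=
  DegLE A d ∧ ∀ e : ℕ, DegLE A e → d ≤ e

/-- `A` satisfies a (nonzero) multilinear identity of degree `b`. -/
def SatisfiesMultilinearIdentity (A : Type) [Ring A] (b : ℕ) : Prop :=
  ∃ c : Equiv.Perm (Fin b) → ℤ, c ≠ 0 ∧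
    ∀ f : Fin b → A,
      ∑ σ : Equiv.Perm (Fin b), c σ • (List.ofFn fun i => f (σ i)).prod = 0

/-- The P.I. degree of `A`: half the smallest degree of a multilinear identity of `A`. -/
noncomputable def piDeg (A : Type) [Ring A] : ℕ :=
  sInf {b : ℕ | 0 < b ∧ SatisfiesMultilinearIdentity A b} / 2

/-- `A` is a P.I. algebra. -/
def IsPIAlgebra (A : Type) [Ring A] : Prop :=
  ∃ b : ℕ, 0 < b ∧ SatisfiesMultilinearIdentity A b

/-- `A` is a prime ring. -/
def IsPrimeRing' (A : Type) [Ring A] : Prop :=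
  ∀ a b : A, (∀ x : A, a * x * b = 0) → a = 0 ∨ b = 0

/-- A two-sided ideal is maximal. -/
def TwoSidedIdeal.IsMaximal' {A : Type} [Ring A] (I : TwoSidedIdeal A) : Prop :=
  I ≠ ⊤ ∧ ∀ J : TwoSidedIdeal A, I < J → J = ⊤

/-- The multilinear polynomial with coefficients `c` vanishes on `A`. -/
def IsMultilinearIdentity (A : Type*) [Ring A] {b : ℕ} (c : Equiv.Perm (Fin b) → ℤ) : Prop :=
  ∀ f : Fin b → A, ∑ σ : Equiv.Perm (Fin b), c σ • (List.ofFn fun i => f (σ i)).prod = 0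

namespace IsMultilinearIdentity

variable {A B : Type*} [Ring A] [Ring B] {b : ℕ} {c : Equiv.Perm (Fin b) → ℤ}

lemma map_sum_smul_prod (g : A →+* B) (c : Equiv.Perm (Fin b) → ℤ) (f : Fin b → A) :
    g (∑ σ : Equiv.Perm (Fin b), c σ • (List.ofFn fun i => f (σ i)).prod) =
      ∑ σ : Equiv.Perm (Fin b), c σ • (List.ofFn fun i => g (f (σ i))).prod := by
  simp only [map_sum, map_zsmul, map_list_prod, List.map_ofFn]
  rfl

lemma of_surjective (h : IsMultilinearIdentity A c) (g : A →+* B) (hg : Function.Surjective g) :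
    IsMultilinearIdentity B c := by
  intro f
  choose f' hf' using fun i => hg (f i)
  obtain rfl : (fun i => g (f' i)) = f := funext hf'
  rw [← map_sum_smul_prod, h, map_zero]

lemma of_injective (h : IsMultilinearIdentity B c) (g : A →+* B) (hg : Function.Injective g) :
    IsMultilinearIdentity A c := by
  intro f
  apply hg
  rw [map_sum_smul_prod, map_zero]
  exact h fun i => g (f i)

/-- A nonzero multilinear identity is impossible as soon as some product of `b` elements acts
nontrivially on a vector that is annihilated by every other ordering of the product. -/
lemma eq_zero_of_smul {V : Type*} [AddCommGroup V] [Module A V] [IsAddTorsionFree V]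
    (h : IsMultilinearIdentity A c) (z : Fin b → A) (u : V)
    (hz : (List.ofFn z).prod • u ≠ 0)
    (hτ : ∀ τ : Equiv.Perm (Fin b), τ ≠ 1 → (List.ofFn fun i => z (τ i)).prod • u = 0) :
    c = 0 := by
  ext ρ
  have key := congrArg (· • u) (h fun i => z (ρ⁻¹ i))
  simp only [Finset.sum_smul, zero_smul] at key
  rw [Finset.sum_eq_single ρ] at key
  · simp only [Equiv.Perm.inv_def, Equiv.symm_apply_apply, smul_assoc] at key
    exact (smul_eq_zero.mp key).resolve_right hz
  · intro σ _ hσ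
    have := hτ (ρ⁻¹ * σ) (by rwa [Ne, inv_mul_eq_one, eq_comm])
    simp only [Equiv.Perm.mul_apply] at this
    rw [smul_assoc, this, smul_zero]
  · simp

end IsMultilinearIdentity

lemma List.isChain_mul_ne_zero_of_prod_ne_zero {R : Type*} [MonoidWithZero R] :
    ∀ l : List R, l.prod ≠ 0 → l.IsChain fun a b => a * b ≠ 0
  | [], _ => by simp
  | [_], _ => by simp
  | a :: b :: l, h => by
    rw [List.prod_cons, List.prod_cons] at h
    refine List.isChain_cons_cons.mpr ⟨fun hab => h ?_, ?_⟩
    · rw [← mul_assoc, hab, zero_mul]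
    · refine List.isChain_mul_ne_zero_of_prod_ne_zero _ fun h0 => h ?_
      rw [← List.prod_cons (a := b), h0, mul_zero]

lemma Equiv.Perm.eq_one_of_strictMono {b : ℕ} {τ : Equiv.Perm (Fin b)} (h : StrictMono τ) :
    τ = 1 := by
  have := Subsingleton.elim (h.orderIsoOfSurjective τ τ.surjective) (OrderIso.refl _)
  ext i
  exact congrArg Fin.val (DFunLike.congr_fun this i)

lemma IsMultilinearIdentity.eq_zero_of_pairwise {A : Type*} [Ring A] [IsAddTorsionFree A]
    {l : List A} {c : Equiv.Perm (Fin l.length) → ℤ} (h : IsMultilinearIdentity A c)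
    (hl : l.Pairwise fun x y => y * x = 0) (hprod : l.prod ≠ 0) : c = 0 := by
  refine h.eq_zero_of_smul (V := A) (fun i => l[i]) 1 (by simpa using hprod) fun τ hτ => ?_
  rw [smul_eq_mul, mul_one]
  by_contra h0
  have hchain := List.isChain_ofFn.mp (List.isChain_mul_ne_zero_of_prod_ne_zero _ h0)
  have hstep : (List.ofFn τ).IsChain (· < ·) := by
    refine List.isChain_ofFn.mpr fun i hi => lt_of_le_of_ne (not_lt.mp fun hlt => ?_) ?_
    · exact hchain i hi (List.pairwise_iff_getElem.mp hl _ _ _ _ hlt)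
    · simp
  rw [List.isChain_iff_pairwise, List.pairwise_ofFn] at hstep
  exact hτ (Equiv.Perm.eq_one_of_strictMono hstep)

section Nil

variable {A : Type} [Ring A]

/-- A nonzero nil left ideal of a prime ring contains arbitrarily long sequences with nonzero
product in which every product in the reversed order vanishes. -/
lemma IsPrimeRing'.exists_list_of_nil (hprime : IsPrimeRing' A) (b : ℕ) :
    ∀ L : Ideal A, L ≠ ⊥ → (∀ x ∈ L, IsNilpotent x) →
      ∃ l : List A, l.length = b ∧ (∀ z ∈ l, z ∈ L) ∧ (l.Pairwise fun x y => y * x = 0) ∧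
        ∃ t ∈ L, t * l.prod ≠ 0 := by
  have hmul : ∀ x y : A, x ≠ 0 → y ≠ 0 → ∃ s, x * s * y ≠ 0 := fun x y hx hy => by
    by_contra! hs
    exact (hprime x y hs).elim hx hy
  induction b with
  | zero =>
    intro L hL _
    obtain ⟨t, ht, ht0⟩ := Submodule.exists_mem_ne_zero_of_ne_bot hL
    exact ⟨[], rfl, by simp, by simp, t, ht, by simpa using ht0⟩
  | succ b ih =>
    intro L hL hnil
    obtain ⟨x, hx, hx0⟩ := Submodule.exists_mem_ne_zero_of_ne_bot hL
    obtain ⟨s, hs⟩ := hmul x x hx0 hx0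
    have hx' : x * (s * x) ≠ 0 := by rwa [← mul_assoc]
    have hz : s * x ∈ L := L.mul_mem_left s hx
    obtain ⟨n, hn⟩ := hnil _ hz
    classical
    have hex : ∃ m, ∀ t ∈ L, t * (s * x) ^ (m + 1) = 0 :=
      ⟨n, fun t _ => by rw [pow_succ, hn, zero_mul, mul_zero]⟩
    obtain ⟨m, hm, hmin⟩ : ∃ m, (∀ t ∈ L, t * (s * x) ^ (m + 1) = 0) ∧
        ∀ j < m, ¬ ∀ t ∈ L, t * (s * x) ^ (j + 1) = 0 :=
      ⟨Nat.find hex, Nat.find_spec hex, fun j => Nat.find_min hex⟩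
    cases m with
    | zero => exact absurd (hm x hx) (by simpa using hx')
    | succ m =>
      set y := (s * x) ^ (m + 1) with hy
      have hyL : y ∈ L := by rw [hy, pow_succ]; exact L.mul_mem_left _ hz
      have hyy : ∀ t ∈ L, t * y * y = 0 := fun t ht => by
        have : t * y * y = t * (s * x) ^ (m + 1 + 1) * (s * x) ^ m := by
          rw [hy, mul_assoc, mul_assoc, ← pow_add, ← pow_add]
          congr 2
          omega
        rw [this, hm t ht, zero_mul]
      obtain ⟨u, huL, hu⟩ : ∃ u ∈ L, u * y ≠ 0 := by
        simpa using hmin m (Nat.lt_succ_self m)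
      let L' : Ideal A := Submodule.map (LinearMap.toSpanSingleton A A y) L
      have hL'mem : ∀ z, z ∈ L' ↔ ∃ t ∈ L, t * y = z := fun z => by
        simp [L', LinearMap.toSpanSingleton_apply]
      have hL' : ∀ z ∈ L', z ∈ L := fun z hz => by
        obtain ⟨t, -, rfl⟩ := (hL'mem z).mp hz
        exact L.mul_mem_left _ hyL
      obtain ⟨l, rfl, hlL, hlp, t, ht, htl⟩ := ih L'
        (fun h => hu ((Submodule.eq_bot_iff _).mp h _ ((hL'mem _).mpr ⟨u, huL, rfl⟩)))
        (fun z hz => hnil z (hL' z hz))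
      obtain ⟨r, hr⟩ := hmul (u * y) (t * l.prod) hu htl
      refine ⟨(y * (r * t)) :: l, rfl, ?_, ?_, u, huL, ?_⟩
      · rintro z (_ | ⟨_, hz⟩)
        · exact L.mul_mem_left _ (L.mul_mem_left _ (hL' t ht))
        · exact hL' z (hlL z hz)
      · refine List.pairwise_cons.mpr ⟨fun z hz => ?_, hlp⟩
        obtain ⟨a, ha, rfl⟩ := (hL'mem z).mp (hlL z hz)
        rw [← mul_assoc, hyy a ha, zero_mul]
      · simpa [mul_assoc] using hr

/-- A prime P.I. ring without torsion has no nonzero nil left ideals. -/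
lemma IsPrimeRing'.exists_not_isNilpotent_mul [IsAddTorsionFree A] (hprime : IsPrimeRing' A)
    {b : ℕ} {c : Equiv.Perm (Fin b) → ℤ} (hc : c ≠ 0) (h : IsMultilinearIdentity A c)
    {v : A} (hv : v ≠ 0) : ∃ a, ¬ IsNilpotent (a * v) := by
  by_contra! hnil
  obtain ⟨l, rfl, -, hl, t, -, ht⟩ := hprime.exists_list_of_nil b (Ideal.span {v})
    (by simpa using hv) fun x hx => by
      obtain ⟨a, rfl⟩ := Ideal.mem_span_singleton'.mp hx
      exact hnil a
  exact hc (h.eq_zero_of_pairwise hl (right_ne_zero_of_mul ht))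

end Nil

namespace IsMultilinearIdentity

open TensorProduct in
lemma baseChange {k A : Type*} (K : Type*) [Field k] [Field K] [Algebra k K] [Ring A]
    [Algebra k A] {b : ℕ} {c : Equiv.Perm (Fin b) → ℤ} (h : IsMultilinearIdentity A c) :
    IsMultilinearIdentity (K ⊗[k] A) c := by
  let F : MultilinearMap K (fun _ : Fin b => K ⊗[k] A) (K ⊗[k] A) :=
    ∑ σ : Equiv.Perm (Fin b),
      (c σ : K) • (MultilinearMap.mkPiAlgebraFin K b (K ⊗[k] A)).domDomCongr σ
  have hF (f) : F f = ∑ σ : Equiv.Perm (Fin b), c σ • (List.ofFn fun i => f (σ i)).prod := by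
    simp [F, Int.cast_smul_eq_zsmul]
  have hF0 : F = 0 := by
    refine Module.Basis.ext_multilinear
      (fun _ => Algebra.TensorProduct.basis K (Module.Free.chooseBasis k A)) fun v => ?_
    rw [hF]
    simp only [Algebra.TensorProduct.basis_apply]
    have := map_sum_smul_prod
      (Algebra.TensorProduct.includeRight : A →ₐ[k] K ⊗[k] A).toRingHom c
      fun i => Module.Free.chooseBasis k A (v i)
    exact this.symm.trans (by rw [h fun i => Module.Free.chooseBasis k A (v i), map_zero]; rfl)
  intro f
  rw [← hF, hF0]
  rfl

lemma matrix_of_le {R : Type*} [Ring R] {n N : ℕ} (hn : n ≤ N) {b : ℕ}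
    {c : Equiv.Perm (Fin b) → ℤ} (h : IsMultilinearIdentity (Matrix (Fin N) (Fin N) R) c) :
    IsMultilinearIdentity (Matrix (Fin n) (Fin n) R) c := by
  let p : Matrix (Fin n) (Fin N) R := (1 : Matrix (Fin N) (Fin N) R).submatrix (Fin.castLE hn) id
  let q : Matrix (Fin N) (Fin n) R := (1 : Matrix (Fin N) (Fin N) R).submatrix id (Fin.castLE hn)
  have hpq : p * q = 1 := by
    rw [← Matrix.submatrix_mul _ _ _ id _ Function.bijective_id, mul_one,
      Matrix.submatrix_one _ (Fin.castLE_injective hn)]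
  have hprod (l : List (Matrix (Fin n) (Fin n) R)) :
      p * (l.map fun a => q * a * p).prod * q = l.prod := by
    induction l with
    | nil => simp [hpq]
    | cons a l ih =>
      rw [List.map_cons, List.prod_cons, List.prod_cons, ← ih]
      calc _ = (p * q) * a * (p * (l.map fun a => q * a * p).prod * q) := by
            simp only [Matrix.mul_assoc]
        _ = _ := by rw [hpq, one_mul]
  intro f
  have key := congrArg (fun x => p * x * q) (h fun i => q * f i * p)
  simp only [Matrix.mul_sum, Matrix.sum_mul, Matrix.mul_smul, Matrix.smul_mul, Matrix.mul_zero,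
    Matrix.zero_mul] at key
  rw [← key]
  refine Finset.sum_congr rfl fun σ _ => ?_
  rw [← hprod, List.map_ofFn]
  rfl

end IsMultilinearIdentity

section Shift

variable {B V : Type*} [Ring B] [AddCommGroup V] [Module B V]

lemma List.prod_map_smul_of_shift {b : ℕ} {z : ℕ → B} {v : ℕ → V}
    (hz : ∀ i < b, ∀ j ≤ b, z i • v j = if j = i + 1 then v i else 0) (l : List ℕ) :
    (∀ i ∈ l, i < b) → ∀ m ≤ b, (l.map z).prod • v m =
      if l.length ≤ m ∧ l = List.range' (m - l.length) l.length then v (m - l.length) else 0 := by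
  induction l using List.reverseRecOn with
  | nil => simp
  | append_singleton l i ih =>
    intro hl m hm
    have hi : i < b := hl i (by simp)
    have hl' : ∀ j ∈ l, j < b := fun j hj => hl j (by simp [hj])
    rw [List.map_append, List.prod_append, mul_smul]
    simp only [List.map_cons, List.map_nil, List.prod_cons, List.prod_nil, mul_one,
      List.length_append, List.length_cons, List.length_nil, zero_add, List.range'_concat]
    rw [hz i hi m hm]
    by_cases hmi : m = i + 1
    · subst hmi
      rw [if_pos rfl, ih hl' i hi.le]
      have h1 : i + 1 - (l.length + 1) = i - l.length := by omega
      rw [h1]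
      refine if_congr ?_ rfl rfl
      constructor
      · rintro ⟨h, h'⟩
        refine ⟨by omega, ?_⟩
        rw [← h']
        congr 2
        omega
      · rintro ⟨h, h'⟩
        exact ⟨by omega, (List.append_inj' h' rfl).1⟩
    · rw [if_neg hmi, smul_zero, if_neg]
      rintro ⟨h, h'⟩
      have := (List.append_inj' h' rfl).2
      simp only [List.cons.injEq, and_true] at this
      omega

lemma IsMultilinearIdentity.eq_zero_of_shift [IsAddTorsionFree V] {b : ℕ}
    {c : Equiv.Perm (Fin b) → ℤ} (h : IsMultilinearIdentity B c) {z : ℕ → B} {v : ℕ → V}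
    (hv : v 0 ≠ 0) (hz : ∀ i < b, ∀ j ≤ b, z i • v j = if j = i + 1 then v i else 0) : c = 0 := by
  have key (τ : Fin b → Fin b) : (List.ofFn fun i => z (τ i)).prod • v b =
      if List.ofFn (fun i => (τ i : ℕ)) = List.range b then v 0 else 0 := by
    have := List.prod_map_smul_of_shift hz (List.ofFn fun i => (τ i : ℕ))
      (by simp) b le_rfl
    rw [List.map_ofFn] at this
    simpa [List.range_eq_range', Function.comp_def] using this
  refine h.eq_zero_of_smul (fun i => z i) (v b) ?_ fun τ hτ => ?_
  · have := key id
    rw [if_pos] at this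
    · exact this.symm ▸ hv
    · exact List.ext_getElem (by simp) (by simp)
  · rw [key τ, if_neg]
    intro hl
    apply hτ
    ext i
    have := congrArg (fun l => l[(i : ℕ)]?) hl
    simpa using this

end Shift

section Density

variable {K B V : Type*} [Field K] [Ring B] [Algebra K B] [AddCommGroup V] [Module K V]
  [Module B V] [IsScalarTower K B V]

lemma LinearMap.exists_smul_eq_of_isSimpleModule [IsSimpleModule B V]
    (hEnd : Function.Surjective (algebraMap K (Module.End B V))) (g : V →ₗ[K] V) (s : Finset V) :
    ∃ r : B, ∀ m ∈ s, g m = r • m := by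
  let g' : Module.End (Module.End B V) V :=
    { toFun := g
      map_add' := g.map_add
      map_smul' := fun f m => by
        obtain ⟨a, rfl⟩ := hEnd f
        exact g.map_smul a m }
  exact jacobson_density g' s

lemma LinearIndependent.exists_linearMap_apply_eq {ι W : Type*} [AddCommGroup W] [Module K W]
    {v : ι → V} (hv : LinearIndependent K v) (w : ι → W) : ∃ g : V →ₗ[K] W, ∀ i, g (v i) = w i := by
  obtain ⟨p, hp⟩ := LinearMap.exists_leftInverse_of_injective (Finsupp.linearCombination K v)
    (LinearMap.ker_eq_bot.mpr hv)
  refine ⟨Finsupp.linearCombination K w ∘ₗ p, fun i => ?_⟩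
  have := LinearMap.congr_fun hp (Finsupp.single i 1)
  simp only [LinearMap.comp_apply, Finsupp.linearCombination_single, one_smul,
    LinearMap.id_apply] at this
  simp [this]

/-- A simple module with only scalar endomorphisms over an algebra with a multilinear identity of
degree `b` has dimension at most `b`. -/
lemma IsMultilinearIdentity.rank_le [CharZero K] [IsSimpleModule B V]
    (hEnd : Function.Surjective (algebraMap K (Module.End B V))) {b : ℕ}
    {c : Equiv.Perm (Fin b) → ℤ} (hc : c ≠ 0) (h : IsMultilinearIdentity B c) :
    Module.rank K V ≤ b := by
  classical
  by_contra hlt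
  obtain ⟨s, hs, hsl⟩ := exists_finset_linearIndependent_of_le_rank (R := K) (M := V) (n := b + 1)
    (by
      rw [Nat.cast_succ, ← Cardinal.succ_natCast]
      exact Order.succ_le_of_lt (not_le.mp hlt))
  have : IsAddTorsionFree V := .of_isTorsionFree K V
  let e : Fin (b + 1) ≃ s := (Fintype.equivFinOfCardEq (by simpa using hs)).symm
  let v : ℕ → V := fun i => if hi : i < b + 1 then e ⟨i, hi⟩ else 0
  have hvl : LinearIndependent K fun i : Fin (b + 1) => v i := by
    convert! (show LinearIndependent K (fun i : s => (i : V)) from hsl).comp e e.injective using 2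
    rename_i i
    simp [v, i.is_lt, -Order.lt_add_one_iff]
  have hz (i : ℕ) : ∃ r : B, ∀ j ≤ b, r • v j = if j = i + 1 then v i else 0 := by
    obtain ⟨g, hg⟩ := hvl.exists_linearMap_apply_eq
      fun j => if (j : ℕ) = i + 1 then v i else 0
    obtain ⟨r, hr⟩ := g.exists_smul_eq_of_isSimpleModule hEnd
      (Finset.univ.image fun j : Fin (b + 1) => v j)
    refine ⟨r, fun j hj => ?_⟩
    rw [← hr _ (Finset.mem_image.mpr ⟨⟨j, Nat.lt_succ_of_le hj⟩, Finset.mem_univ _, rfl⟩)]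
    exact hg ⟨j, Nat.lt_succ_of_le hj⟩
  choose z hz using hz
  exact hc (h.eq_zero_of_shift (hvl.ne_zero 0) fun i _ => hz i)

lemma IsSimpleModule.lsmul_surjective [FiniteDimensional K V] [IsSimpleModule B V]
    (hEnd : Function.Surjective (algebraMap K (Module.End B V))) :
    Function.Surjective (Algebra.lsmul K K V : B →ₐ[K] Module.End K V) := by
  classical
  intro g
  let e := Module.finBasis K V
  obtain ⟨r, hr⟩ := g.exists_smul_eq_of_isSimpleModule hEnd (Finset.univ.image e)
  refine ⟨r, e.ext fun i => ?_⟩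
  exact (hr _ (Finset.mem_image_of_mem _ (Finset.mem_univ i))).symm

end Density

section Resolvent

open Cardinal Polynomial

/-- Left inverses of `x - a`, for distinct scalars `a`, are linearly independent when `x` is
transcendental. -/
lemma Transcendental.linearIndependent_of_mul_sub_eq_one {F E ι : Type*} [Field F] [Ring E]
    [Algebra F E] {x : E} (H : Transcendental F x) {a : ι → F} (ha : Function.Injective a)
    {r : ι → E} (hr : ∀ i, r i * (x - algebraMap F E (a i)) = 1) : LinearIndependent F r := by
  classical
  refine linearIndependent_iff'.2 fun s m hm i hi => ?_
  let p : F[X] := ∑ j ∈ s, C (m j) * ∏ l ∈ s.erase j, (X - C (a l))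
  have hp : Polynomial.aeval x p = 0 := by
    have := congrArg (· * Polynomial.aeval x (∏ l ∈ s, (X - C (a l)))) hm
    simp only [zero_mul, Finset.sum_mul] at this
    rw [← this]
    simp only [p, map_sum]
    refine Finset.sum_congr rfl fun j hj => ?_
    rw [← Finset.mul_prod_erase s _ hj, map_mul, map_mul, aeval_C, map_sub, aeval_X, aeval_C,
      smul_mul_assoc, ← mul_assoc (r j), hr j, one_mul, Algebra.smul_def]
  have hp0 : p = 0 := by
    by_contra hne
    exact H ⟨p, hne, hp⟩
  have heval := congrArg (eval (a i)) hp0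
  simp only [p, eval_finsetSum, eval_mul, eval_C, eval_prod, eval_sub, eval_X, eval_zero] at heval
  rw [Finset.sum_eq_single i] at heval
  · refine (mul_eq_zero.mp heval).resolve_right (Finset.prod_ne_zero_iff.mpr fun l hl => ?_)
    exact sub_ne_zero.mpr (ha.ne (Finset.ne_of_mem_erase hl).symm)
  · intro j _ hji
    rw [Finset.prod_eq_zero (Finset.mem_erase.mpr ⟨hji.symm, hi⟩) (sub_self _), mul_zero]
  · exact fun h => absurd hi h

/-- A non-nilpotent element of an algebra of dimension less than `#K` has a nonzero scalar
in its left spectrum. -/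
lemma exists_ne_zero_forall_mul_sub_ne_one {K B : Type} [Field K] [IsAlgClosed K] [Ring B]
    [Algebra K B] (hrank : Module.rank K B < #K) {w : B} (hw : ¬ IsNilpotent w) :
    ∃ a : K, a ≠ 0 ∧ ∀ r, r * (w - algebraMap K B a) ≠ 1 := by
  have : Infinite K := IsAlgClosed.instInfinite
  have : Nontrivial B := by
    by_contra h
    rw [not_nontrivial_iff_subsingleton] at h
    exact hw ⟨1, Subsingleton.elim _ _⟩
  by_contra! hinv
  by_cases halg : Transcendental K w
  · choose r hr using hinv
    have hli := halg.linearIndependent_of_mul_sub_eq_one (ι := {a : K // a ≠ 0})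
      Subtype.val_injective (fun i => hr i.1 i.2)
    refine hrank.not_ge (le_trans (le_of_eq ?_) hli.cardinal_le_rank)
    exact (Cardinal.mk_compl_of_infinite {(0 : K)} (by simp [Cardinal.one_lt_aleph0.trans_le])).symm
  · obtain ⟨p, hp0, hp⟩ := not_not.mp halg
    have key (s : Multiset K) : ∀ y : B,
        Polynomial.aeval w (s.map fun a => X - C a).prod * y = 0 → ∃ m, w ^ m * y = 0 := by
      induction s using Multiset.induction with
      | empty => exact fun y hy => ⟨0, by simpa using hy⟩
      | cons a s ih =>
        intro y hy
        rw [Multiset.map_cons, Multiset.prod_cons] at hy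
        by_cases ha : a = 0
        · obtain ⟨m, hm⟩ := ih (w * y) (by
            rw [mul_comm, map_mul, ha, C_0, sub_zero, aeval_X, mul_assoc] at hy
            exact hy)
          exact ⟨m + 1, by rw [pow_succ, mul_assoc, hm]⟩
        · obtain ⟨r, hr⟩ := hinv a ha
          rw [map_mul, map_sub, aeval_X, aeval_C, mul_assoc] at hy
          have := congrArg (r * ·) hy
          simp only [mul_zero, ← mul_assoc, hr, one_mul] at this
          exact ih y this
    rw [(IsAlgClosed.splits p).eq_prod_roots, map_mul, aeval_C] at hp
    obtain ⟨m, hm⟩ := key p.roots 1 (by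
      rw [mul_one]
      have := congrArg (algebraMap K B p.leadingCoeff⁻¹ * ·) hp
      simpa [← mul_assoc, ← map_mul, leadingCoeff_ne_zero.mpr hp0] using this)
    exact hw ⟨m, by simpa using hm⟩

/-- Schur's lemma for simple modules of dimension less than `#K`. -/
lemma IsSimpleModule.algebraMap_end_surjective_of_rank_lt {K B V : Type} [Field K] [IsAlgClosed K]
    [Ring B] [Algebra K B] [AddCommGroup V] [Module K V] [Module B V] [IsScalarTower K B V]
    [IsSimpleModule B V] (hrank : Module.rank K V < #K) :
    Function.Surjective (algebraMap K (Module.End B V)) := by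
  classical
  have : Nontrivial V := IsSimpleModule.nontrivial B V
  obtain ⟨u, hu⟩ := exists_ne (0 : V)
  have hrank' : Module.rank K (Module.End B V) < #K := by
    let ev : Module.End B V →ₗ[K] V :=
      { toFun := fun f => f u, map_add' := fun _ _ => rfl, map_smul' := fun _ _ => rfl }
    refine (LinearMap.rank_le_of_injective ev ?_).trans_lt hrank
    refine (injective_iff_map_eq_zero ev).mpr fun f hf => ?_
    by_contra hne
    exact hu ((LinearMap.bijective_of_ne_zero hne).1 (hf.trans (map_zero f).symm))
  have : Algebra.IsIntegral K (Module.End B V) := by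
    refine ⟨fun f => ?_⟩
    rw [← isAlgebraic_iff_isIntegral]
    by_contra htr
    have hinv (a : K) : ∃ r, r * (f - algebraMap K _ a) = 1 := by
      refine ⟨(f - algebraMap K _ a)⁻¹, inv_mul_cancel₀ fun h => htr ?_⟩
      rw [sub_eq_zero.mp h]
      exact isAlgebraic_algebraMap a
    choose r hr using hinv
    exact hrank'.not_ge (Transcendental.linearIndependent_of_mul_sub_eq_one htr
      Function.injective_id hr).cardinal_le_rank
  exact (IsAlgClosed.algebraMap_bijective_of_isIntegral (k := K)).2

end Resolvent

section Representation

open Cardinal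

/-- An algebra of dimension less than `#K` with a multilinear identity has, for each non-nilpotent
element `w`, an absolutely irreducible matrix representation in which `w` is not nilpotent. -/
lemma IsMultilinearIdentity.exists_surjective_algHom_matrix_of_rank_lt {K B : Type} [Field K]
    [IsAlgClosed K] [CharZero K] [Ring B] [Algebra K B] (hrank : Module.rank K B < #K) {b : ℕ}
    {c : Equiv.Perm (Fin b) → ℤ} (hc : c ≠ 0) (h : IsMultilinearIdentity B c) {w : B}
    (hw : ¬ IsNilpotent w) :
    ∃ n ≤ b, ∃ φ : B →ₐ[K] Matrix (Fin n) (Fin n) K,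
      Function.Surjective φ ∧ ¬ IsNilpotent (φ w) := by
  obtain ⟨a, ha, hr⟩ := exists_ne_zero_forall_mul_sub_ne_one hrank hw
  obtain ⟨L, hL, hle⟩ := Ideal.exists_le_maximal (Ideal.span {w - algebraMap K B a}) (by
    rw [Ne, Ideal.eq_top_iff_one, Ideal.mem_span_singleton']
    exact fun ⟨r, h⟩ => hr r h)
  have hmem : w - algebraMap K B a ∈ L := hle (Ideal.mem_span_singleton_self _)
  have : IsSimpleModule B (B ⧸ L) := isSimpleModule_iff_isCoatom.mpr hL.out
  have hEnd : Function.Surjective (algebraMap K (Module.End B (B ⧸ L))) :=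
    IsSimpleModule.algebraMap_end_surjective_of_rank_lt ((LinearMap.rank_le_of_surjective
      (L.mkQ.restrictScalars K) L.mkQ_surjective).trans_lt hrank)
  have hle := h.rank_le (V := B ⧸ L) hEnd hc
  have : FiniteDimensional K (B ⧸ L) :=
    Module.rank_lt_aleph0_iff.mp (hle.trans_lt (Cardinal.natCast_lt_aleph0))
  have hn : Module.finrank K (B ⧸ L) ≤ b := by
    rw [← Module.finrank_eq_rank] at hle
    exact_mod_cast hle
  let e := LinearMap.toMatrixAlgEquiv (Module.finBasis K (B ⧸ L))
  refine ⟨_, hn, e.toAlgHom.comp (Algebra.lsmul K K (B ⧸ L)),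
    e.surjective.comp (IsSimpleModule.lsmul_surjective hEnd), ?_⟩
  rintro ⟨m, hm⟩
  have hm' : (Algebra.lsmul K K (B ⧸ L) w : Module.End K (B ⧸ L)) ^ m = 0 :=
    e.injective (by rw [map_pow, map_zero]; exact hm)
  have hu : w • L.mkQ 1 = a • L.mkQ 1 := by
    rw [← sub_eq_zero, ← map_smul, ← algebraMap_smul B a (L.mkQ 1), ← map_smul, ← map_sub]
    simpa using sub_eq_zero.mpr ((Submodule.Quotient.eq L).mpr hmem)
  have hpow (j : ℕ) : w ^ j • L.mkQ 1 = a ^ j • L.mkQ 1 := by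
    induction j with
    | zero => simp
    | succ j ih => rw [pow_succ, mul_smul, hu, smul_comm, ih, smul_smul, pow_succ, mul_comm]
  have h0 : a ^ m • L.mkQ 1 = 0 := by
    rw [← hpow]
    rw [← map_pow] at hm'
    exact LinearMap.congr_fun hm' (L.mkQ 1)
  rw [smul_eq_zero_iff_right (pow_ne_zero m ha)] at h0
  exact hL.ne_top ((Ideal.eq_top_iff_one L).mpr ((Submodule.Quotient.mk_eq_zero L).mp h0))

/-- Nonzero elements of affine domains over algebraically closed fields do not vanish at some
rational point. -/
lemma exists_algHom_apply_ne_zero {k R : Type*} [Field k] [IsAlgClosed k] [CommRing R] [IsDomain R]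
    [Algebra k R] [Algebra.FiniteType k R] {r : R} (hr : r ≠ 0) : ∃ ψ : R →ₐ[k] k, ψ r ≠ 0 := by
  have : IsJacobsonRing R := isJacobsonRing_of_finiteType (A := k)
  have hjac : (⊥ : Ideal R).jacobson = ⊥ := IsJacobsonRing.out ‹_› Ideal.isPrime_bot.isRadical
  obtain ⟨m, hm, hrm⟩ : ∃ m : Ideal R, m.IsMaximal ∧ r ∉ m := by
    by_contra! hall
    refine hr ?_
    rw [← Ideal.mem_bot, ← hjac, Ideal.jacobson, Ideal.mem_sInf]
    exact fun {J} hJ => hall J hJ.2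
  let := Ideal.Quotient.field m
  have : Module.Finite k (R ⧸ m) := finite_of_finite_type_of_isJacobsonRing k (R ⧸ m)
  let e : k ≃ₐ[k] R ⧸ m := AlgEquiv.ofBijective (Algebra.ofId k (R ⧸ m))
    IsAlgClosed.algebraMap_bijective_of_isIntegral
  refine ⟨e.symm.toAlgHom.comp (Ideal.Quotient.mkₐ k m), fun h0 => hrm ?_⟩
  exact Ideal.Quotient.eq_zero_iff_mem.mp ((map_eq_zero_iff _ e.symm.injective).mp h0)

lemma Matrix.pow_eq_zero_of_isNilpotent {R : Type*} [CommRing R] [IsDomain R] {n : ℕ}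
    {M : Matrix (Fin n) (Fin n) R} (hM : IsNilpotent M) : M ^ n = 0 := by
  have h := sub_eq_zero.mp (Matrix.isNilpotent_charpoly_sub_pow_of_isNilpotent hM).eq_zero
  simpa [h] using M.aeval_self_charpoly

/-- A matrix representation of an affine algebra over an extension of the algebraically closed base
field specializes to the base field, preserving non-nilpotency of a given element. -/
lemma exists_algHom_matrix_of_field_extension {k K A : Type*} [Field k] [IsAlgClosed k] [Field K]
    [Algebra k K] [Ring A] [Algebra k A] [Algebra.FiniteType k A] {n : ℕ}
    (φ : A →ₐ[k] Matrix (Fin n) (Fin n) K) {w : A} (hw : ¬ IsNilpotent (φ w)) :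
    ∃ φ' : A →ₐ[k] Matrix (Fin n) (Fin n) k, ¬ IsNilpotent (φ' w) := by
  obtain ⟨s, hs⟩ := Algebra.FiniteType.out (R := k) (A := A)
  let S : Subalgebra k K :=
    Algebra.adjoin k (Set.range fun p : s × Fin n × Fin n => φ p.1 p.2.1 p.2.2)
  have hS : ∀ a ∈ s, ∀ i j, φ a i j ∈ S := fun a ha i j =>
    Algebra.subset_adjoin ⟨(⟨a, ha⟩, i, j), rfl⟩
  have : Algebra.FiniteType k S :=
    Subalgebra.fg_iff_finiteType S |>.mp (Subalgebra.fg_def.mpr ⟨_, Set.finite_range _, rfl⟩)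
  let ι : Matrix (Fin n) (Fin n) S →ₐ[k] Matrix (Fin n) (Fin n) K := S.val.mapMatrix
  have hι : Function.Injective ι := Matrix.map_injective Subtype.val_injective
  have hle : Algebra.adjoin k (s : Set A) ≤ ι.range.comap φ := Algebra.adjoin_le fun a ha =>
    ⟨Matrix.of fun i j => ⟨φ a i j, hS a ha i j⟩, rfl⟩
  let χ : A →ₐ[k] Matrix (Fin n) (Fin n) S := (AlgEquiv.ofInjective ι hι).symm.toAlgHom.comp
    (φ.codRestrict ι.range fun a => hle (hs ▸ Algebra.mem_top))
  have hχ (a : A) : ι (χ a) = φ a :=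
    congrArg Subtype.val ((AlgEquiv.ofInjective ι hι).apply_symm_apply _)
  have hne : χ w ^ n ≠ 0 := fun h0 => hw ⟨n, by rw [← hχ, ← map_pow, h0, map_zero]⟩
  obtain ⟨i, j, hij⟩ : ∃ i j, (χ w ^ n) i j ≠ 0 := by
    by_contra! h0
    exact hne (Matrix.ext h0)
  obtain ⟨ψ, hψ⟩ := exists_algHom_apply_ne_zero (k := k) hij
  refine ⟨ψ.mapMatrix.comp χ, fun hnil => hψ ?_⟩
  have h0 := Matrix.pow_eq_zero_of_isNilpotent hnil
  rw [← map_pow, AlgHom.comp_apply, map_pow] at h0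
  exact congrFun (congrFun h0 i) j

lemma exists_isAlgClosed_aleph0_lt (k : Type) [Field k] :
    ∃ (K : Type) (_ : Field K) (_ : Algebra k K), IsAlgClosed K ∧ ℵ₀ < #K := by
  let F := FractionRing (MvPolynomial ℝ k)
  refine ⟨AlgebraicClosure F, inferInstance, inferInstance, inferInstance, ?_⟩
  have hinj : Function.Injective fun r : ℝ =>
      algebraMap F (AlgebraicClosure F) (algebraMap (MvPolynomial ℝ k) F (MvPolynomial.X r)) :=
    (algebraMap F (AlgebraicClosure F)).injective.comp
      ((IsFractionRing.injective _ _).comp (MvPolynomial.X_injective))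
  exact (Cardinal.mk_real ▸ Cardinal.aleph0_lt_continuum).trans_le (Cardinal.mk_le_of_injective hinj)

lemma Algebra.FiniteType.rank_le_aleph0 (k A : Type) [Field k] [Ring A] [Algebra k A]
    [h : Algebra.FiniteType k A] : Module.rank k A ≤ ℵ₀ := by
  obtain ⟨s, hs⟩ := h.out
  have := Algebra.rank_adjoin_le (R := k) (s : Set A)
  rw [hs] at this
  rw [← rank_top]
  refine this.trans (max_le ?_ le_rfl)
  exact Cardinal.mk_le_aleph0

open TensorProduct in
/-- An affine P.I. algebra over an algebraically closed field of characteristic zero has, for each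
non-nilpotent element `w`, an irreducible matrix representation in which `w` is not nilpotent. -/
lemma IsMultilinearIdentity.exists_surjective_algHom_matrix {k A : Type} [Field k] [IsAlgClosed k]
    [CharZero k] [Ring A] [Algebra k A] [Algebra.FiniteType k A] {b : ℕ}
    {c : Equiv.Perm (Fin b) → ℤ} (hc : c ≠ 0) (h : IsMultilinearIdentity A c) {w : A}
    (hw : ¬ IsNilpotent w) :
    ∃ n ≤ b, ∃ φ : A →ₐ[k] Matrix (Fin n) (Fin n) k,
      Function.Surjective φ ∧ ¬ IsNilpotent (φ w) := by
  obtain ⟨K, _, _, _, hK⟩ := exists_isAlgClosed_aleph0_lt k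
  have : CharZero K := charZero_of_injective_algebraMap (algebraMap k K).injective
  have hinc : Function.Injective (Algebra.TensorProduct.includeRight : A →ₐ[k] K ⊗[k] A) :=
    Algebra.TensorProduct.includeRight_injective (algebraMap k K).injective
  have hrank : Module.rank K (K ⊗[k] A) < #K := by
    rw [Module.rank_baseChange, Cardinal.lift_id]
    exact (Algebra.FiniteType.rank_le_aleph0 k A).trans_lt hK
  obtain ⟨N, -, φK, -, hφK⟩ := (h.baseChange K).exists_surjective_algHom_matrix_of_rank_lt hrank hc
    (w := Algebra.TensorProduct.includeRight w)
    (by rwa [IsNilpotent.map_iff hinc])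
  obtain ⟨φ, hφ⟩ := exists_algHom_matrix_of_field_extension
    ((φK.restrictScalars k).comp Algebra.TensorProduct.includeRight) hφK
  have hrank' : Module.rank k φ.range < #k :=
    (Module.rank_lt_aleph0 k φ.range).trans_le (Cardinal.aleph0_le_mk_iff.mpr
      IsAlgClosed.instInfinite)
  obtain ⟨n, hn, φ', hφ', hw'⟩ :=
    (h.of_surjective φ.rangeRestrict.toRingHom
      φ.rangeRestrict_surjective).exists_surjective_algHom_matrix_of_rank_lt hrank' hc
    (w := φ.rangeRestrict w) fun hnil => hφ (hnil.map φ.range.val)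
  exact ⟨n, hn, φ'.comp φ.rangeRestrict, hφ'.comp φ.rangeRestrict_surjective, hw'⟩

end Representation

lemma TwoSidedIdeal.isMaximal'_ker {A B : Type} [Ring A] [Ring B] [IsSimpleRing B] (φ : A →+* B)
    (hφ : Function.Surjective φ) : (TwoSidedIdeal.ker φ).IsMaximal' := by
  constructor
  · intro h
    have : (1 : A) ∈ TwoSidedIdeal.ker φ := h ▸ trivial
    rw [TwoSidedIdeal.mem_ker, map_one] at this
    exact one_ne_zero this
  · intro J hJ
    obtain ⟨x, hxJ, hx⟩ := SetLike.exists_of_lt hJ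
    let J' : TwoSidedIdeal B := TwoSidedIdeal.mk' (φ '' J) ⟨0, J.zero_mem, map_zero φ⟩
      (by
        rintro _ _ ⟨y, hy, rfl⟩ ⟨z, hz, rfl⟩
        exact ⟨y + z, J.add_mem hy hz, map_add φ y z⟩)
      (by
        rintro _ ⟨y, hy, rfl⟩
        exact ⟨-y, J.neg_mem hy, map_neg φ y⟩)
      (by
        rintro z _ ⟨y, hy, rfl⟩
        obtain ⟨z, rfl⟩ := hφ z
        exact ⟨z * y, J.mul_mem_left _ _ hy, map_mul φ z y⟩)
      (by
        rintro _ z ⟨y, hy, rfl⟩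
        obtain ⟨z, rfl⟩ := hφ z
        exact ⟨y * z, J.mul_mem_right _ _ hy, map_mul φ y z⟩)
    have hJ' (y : B) : y ∈ J' ↔ ∃ z ∈ J, φ z = y := TwoSidedIdeal.mem_mk' _ _ _ _ _ _ _
    rcases eq_bot_or_eq_top J' with h | h
    · refine absurd ?_ hx
      rw [TwoSidedIdeal.mem_ker, ← TwoSidedIdeal.mem_bot, ← h, hJ']
      exact ⟨x, hxJ, rfl⟩
    · obtain ⟨z, hz, hz1⟩ := (hJ' 1).mp (h ▸ trivial)
      have hk : 1 - z ∈ J := hJ.le (by rw [TwoSidedIdeal.mem_ker, map_sub, map_one, hz1, sub_self])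
      rw [← TwoSidedIdeal.one_mem_iff, ← sub_add_cancel 1 z]
      exact J.add_mem hk hz

lemma IsMultilinearIdentity.of_quotient_ker {A B : Type} [Ring A] [Ring B] {φ : A →+* B}
    (hφ : Function.Surjective φ) {b : ℕ} {c : Equiv.Perm (Fin b) → ℤ}
    (h : IsMultilinearIdentity (TwoSidedIdeal.ker φ).ringCon.Quotient c) :
    IsMultilinearIdentity B c := by
  refine h.of_surjective ((TwoSidedIdeal.ker φ).ringCon.lift φ fun x y hxy => hxy) fun y => ?_
  obtain ⟨x, rfl⟩ := hφ y
  exact ⟨(TwoSidedIdeal.ker φ).ringCon.mk' x, rfl⟩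

lemma SatisfiesMultilinearIdentity.quotient {A : Type} [Ring A] {b : ℕ}
    (h : SatisfiesMultilinearIdentity A b) (I : TwoSidedIdeal A) :
    SatisfiesMultilinearIdentity I.ringCon.Quotient b := by
  obtain ⟨c, hc, h⟩ := h
  exact ⟨c, hc, IsMultilinearIdentity.of_surjective h I.ringCon.mk' I.ringCon.mk'_surjective⟩

lemma piDeg_quotient_le {A : Type} [Ring A] (hPI : IsPIAlgebra A) (I : TwoSidedIdeal A) :
    piDeg I.ringCon.Quotient ≤ piDeg A :=
  Nat.div_le_div_right (csInf_le_csInf (OrderBot.bddBelow _) hPI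
    fun _ h => ⟨h.1, h.2.quotient I⟩)

lemma piDeg_of_subsingleton (A : Type) [Ring A] [Subsingleton A] : piDeg A = 0 := by
  have h1 : sInf {b : ℕ | 0 < b ∧ SatisfiesMultilinearIdentity A b} ≤ 1 :=
    Nat.sInf_le ⟨one_pos, fun _ => 1, fun h => one_ne_zero (congrFun h 1),
      fun _ => Subsingleton.elim _ _⟩
  exact Nat.div_eq_of_lt (h1.trans_lt one_lt_two)

/-- Some quotient of an affine prime P.I. algebra by a maximal ideal has the same multilinear
identities as the algebra itself. -/
lemma exists_isMaximal'_forall_satisfiesMultilinearIdentity_iff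
    (k A : Type) [Field k] [IsAlgClosed k] [CharZero k] [Ring A] [Nontrivial A] [Algebra k A]
    [Algebra.FiniteType k A] (hprime : IsPrimeRing' A) (hPI : IsPIAlgebra A) :
    ∃ I : TwoSidedIdeal A, I.IsMaximal' ∧
      ∀ b, SatisfiesMultilinearIdentity I.ringCon.Quotient b ↔ SatisfiesMultilinearIdentity A b := by
  obtain ⟨b, -, c, hc, h⟩ := hPI
  replace h : IsMultilinearIdentity A c := h
  have : IsAddTorsionFree A := .of_isTorsionFree k A
  let S : Set ℕ := {n | n ≤ b ∧ 0 < n ∧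
    ∃ φ : A →ₐ[k] Matrix (Fin n) (Fin n) k, Function.Surjective φ}
  have hrep {w : A} (hw : ¬ IsNilpotent w) :
      ∃ n ∈ S, ∃ φ : A →ₐ[k] Matrix (Fin n) (Fin n) k, φ w ≠ 0 ∧ Function.Surjective φ := by
    obtain ⟨n, hn, φ, hφ, hnil⟩ := h.exists_surjective_algHom_matrix (k := k) hc hw
    refine ⟨n, ⟨hn, Nat.pos_of_ne_zero ?_, φ, hφ⟩, φ, fun h0 => hnil (h0 ▸ IsNilpotent.zero), hφ⟩
    rintro rfl
    exact hnil ⟨1, Subsingleton.elim _ _⟩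
  have hne : S.Nonempty := (hrep (w := 1) not_isNilpotent_one).imp fun n hn => hn.1
  have hbdd : BddAbove S := ⟨b, fun n hn => hn.1⟩
  obtain ⟨-, hpos, φ, hφ⟩ := Nat.sSup_mem hne hbdd
  have : Nonempty (Fin (sSup S)) := ⟨⟨0, hpos⟩⟩
  refine ⟨TwoSidedIdeal.ker φ.toRingHom, TwoSidedIdeal.isMaximal'_ker _ hφ, fun b' =>
    ⟨fun ⟨c', hc', h'⟩ => ⟨c', hc', fun f => ?_⟩, fun hA => hA.quotient _⟩⟩
  have hmat := IsMultilinearIdentity.of_quotient_ker hφ h'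
  by_contra hv
  obtain ⟨a, ha⟩ := hprime.exists_not_isNilpotent_mul hc h hv
  obtain ⟨n, hn, ψ, hψ, hsurj⟩ := hrep ha
  refine hψ ?_
  have := IsMultilinearIdentity.map_sum_smul_prod ψ.toRingHom c' f
  rw [map_mul]
  refine mul_eq_zero_of_right _ (this.trans ?_)
  exact hmat.matrix_of_le (le_csSup hbdd hn) fun i => ψ (f i)

/-- For an affine prime P.I. algebra `A` over an algebraically closed
field `k` of characteristic zero, the P.I. degree of `A` is the supremum of the
P.I. degrees of the quotients `A/M` over all maximal two-sided ideals `M` of `A`. -/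
theorem piDeg_eq_sSup_piDeg_quotients
    (k A : Type) [Field k] [IsAlgClosed k] [CharZero k] [Ring A] [Algebra k A]
    (haff : Algebra.FiniteType k A) (hprime : IsPrimeRing' A) (hPI : IsPIAlgebra A) :
    piDeg A =
      sSup {p : ℕ | ∃ I : TwoSidedIdeal A, I.IsMaximal' ∧ p = piDeg I.ringCon.Quotient} := by
  have hbound : ∀ p ∈ {p : ℕ | ∃ I : TwoSidedIdeal A, I.IsMaximal' ∧
      p = piDeg I.ringCon.Quotient}, p ≤ piDeg A := by
    rintro _ ⟨I, -, rfl⟩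
    exact piDeg_quotient_le hPI I
  rcases subsingleton_or_nontrivial A with hA | hA
  · rw [piDeg_of_subsingleton A] at hbound ⊢
    exact (Nat.le_zero.mp (csSup_le' hbound)).symm
  · obtain ⟨I, hI, h⟩ :=
      exists_isMaximal'_forall_satisfiesMultilinearIdentity_iff k A hprime hPI
    have hmem : piDeg A ∈ {p : ℕ | ∃ I : TwoSidedIdeal A, I.IsMaximal' ∧
        p = piDeg I.ringCon.Quotient} := ⟨I, hI, by simp only [piDeg, h]⟩
    exact (IsGreatest.csSup_eq ⟨hmem, hbound⟩).symm
end

section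
/- Let A be an affine (finitely generated) prime P.I. algebra over an algebraically closed field k of characteristic 0. Then deg A = sup_S dim_k S, where S runs through all finite-dimensional irreducible (simple) A-modules. -/
open scoped BigOperators

/-- A product of factors `w * u`, each `w` being `z` or of the form `y * u * z`, vanishes after a
multiple of `u * z * u` as soon as `z` occurs among the `w`, provided `u * z * u * z * u = 0`. -/
theorem mul_prod_map_eq_zero_of_mem {A : Type*} [Ring A] {u z : A}
    (huz : u * z * u * z * u = 0) (L : List A)
    (hL : ∀ w ∈ L, w = z ∨ ∃ y, w = y * u * z) (hz : z ∈ L) (d : A) :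
    d * u * z * u * (L.map (· * u)).prod = 0 := by
  induction L generalizing d with
  | nil => simp at hz
  | cons w L ih =>
    have hzero : ∀ t : A, d * u * z * u * (z * u * t) = 0 := fun t => by
      have : d * u * z * u * (z * u * t) = d * (u * z * u * z * u) * t := by noncomm_ring
      rw [this, huz, mul_zero, zero_mul]
    rw [List.map_cons, List.prod_cons]
    rcases hL w (by simp) with rfl | ⟨y, rfl⟩
    · exact hzero _
    · rcases List.mem_cons.1 hz with h | h
      · rw [← h]
        exact hzero _
      · have := ih (fun w hw => hL w (by simp [hw])) h (d * u * z * u * y)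
        rw [← this]
        noncomm_ring

/-- In a prime ring, a nonzero right ideal `uA` that is nil contains some `uzu ≠ 0` with
`uzuzu = 0`. -/
theorem exists_mul_mul_ne_zero_of_nil {A : Type} [Ring A] (hprime : IsPrimeRing' A) {u : A}
    (hu : u ≠ 0) (hnil : ∀ x, IsNilpotent (u * x)) :
    ∃ z, u * z * u ≠ 0 ∧ u * z * u * z * u = 0 := by
  obtain ⟨x, hx⟩ : ∃ x, u * x * u ≠ 0 := by
    by_contra! h
    exact hu (or_self_iff.1 (hprime u u h))
  have hex : ∃ n, (u * x) ^ n * u = 0 := by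
    obtain ⟨n, hn⟩ := hnil x
    exact ⟨n, by rw [hn, zero_mul]⟩
  classical
  have hspec := Nat.find_spec hex
  have hmin := fun m => Nat.find_min hex (m := m)
  generalize Nat.find hex = n at hspec hmin
  match n with
  | 0 => simp [hu] at hspec
  | 1 => simp [hx] at hspec
  | m + 2 =>
    have key : u * (x * (u * x) ^ m) * u = (u * x) ^ (m + 1) * u := by
      rw [pow_succ']
      noncomm_ring
    refine ⟨x * (u * x) ^ m, key ▸ hmin (m + 1) (by omega), ?_⟩
    calc u * (x * (u * x) ^ m) * u * (x * (u * x) ^ m) * u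
        = (u * x) ^ (m + 1) * (u * (x * (u * x) ^ m) * u) := by
          rw [pow_succ']
          simp only [mul_assoc]
      _ = (u * x) ^ m * ((u * x) ^ (m + 2) * u) := by
          rw [key, ← mul_assoc, ← mul_assoc, ← pow_add, ← pow_add]
          congr 2
          omega
      _ = 0 := by rw [hspec, mul_zero]

/-- If a prime ring satisfies a multilinear identity interlaced with `u`, and `uA` is nil, then
`u = 0`. -/
theorem eq_zero_of_nil_of_interlaced_identity {A : Type} [Ring A] (hprime : IsPrimeRing' A)
    (htf : ∀ (n : ℤ) (x : A), n • x = 0 → n = 0 ∨ x = 0) (b : ℕ) (u : A)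
    (hnil : ∀ x, IsNilpotent (u * x)) (c : Equiv.Perm (Fin b) → ℤ) (hc : c ≠ 0)
    (hid : ∀ x : Fin b → A,
      ∑ σ : Equiv.Perm (Fin b), c σ • (u * (List.ofFn fun i => x (σ i) * u).prod) = 0) :
    u = 0 := by
  induction b generalizing u with
  | zero =>
    obtain ⟨τ, hτ⟩ := Function.ne_iff.1 hc
    have := hid 0
    rw [Fintype.sum_subsingleton _ τ] at this
    simpa using (htf _ _ this).resolve_left hτ
  | succ b ih =>
    by_contra hu
    obtain ⟨z, hz0, hz⟩ := exists_mul_mul_ne_zero_of_nil hprime hu hnil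
    obtain ⟨τ, hτ⟩ := Function.ne_iff.1 hc
    set j := τ 0 with hj
    have hτe : Equiv.Perm.decomposeFin.symm (j, (Equiv.Perm.decomposeFin τ).2) = τ := by
      rw [Equiv.symm_apply_eq]
      refine Prod.ext ?_ rfl
      conv_lhs => rw [hj, ← Equiv.symm_apply_apply Equiv.Perm.decomposeFin τ]
      rw [← Prod.mk.eta (p := Equiv.Perm.decomposeFin τ),
        Equiv.Perm.decomposeFin_symm_apply_zero]
    refine hz0 (ih (u * z * u) (fun x => ?_)
      (fun e => c (Equiv.Perm.decomposeFin.symm (j, e))) ?_ fun y => ?_)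
    · have := hnil (z * u * x)
      convert this using 1
      noncomm_ring
    · refine Function.ne_iff.2 ⟨(Equiv.Perm.decomposeFin τ).2, ?_⟩
      simpa only [hτe, Pi.zero_apply] using hτ
    · have h := hid fun i =>
        (Fin.cons z (fun k => y k * u * z) : Fin (b + 1) → A) (Equiv.swap 0 j i)
      rw [← Equiv.sum_comp Equiv.Perm.decomposeFin.symm, Fintype.sum_prod_type,
        Finset.sum_eq_single j] at h
      · rw [← h]
        refine Finset.sum_congr rfl fun e _ => ?_
        congr 1
        rw [List.ofFn_succ, List.prod_cons]
        simp only [Equiv.Perm.decomposeFin_symm_apply_zero,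
          Equiv.Perm.decomposeFin_symm_apply_succ, Equiv.swap_apply_self, Equiv.swap_apply_right,
          Fin.cons_zero, Fin.cons_succ, mul_assoc]
      · intro p _ hp
        refine Finset.sum_eq_zero fun e _ => ?_
        set σ := Equiv.Perm.decomposeFin.symm (p, e) with hσ
        have hσ0 : σ 0 = p := Equiv.Perm.decomposeFin_symm_apply_zero p e
        have hs0 : Equiv.swap 0 j (σ 0) ≠ 0 := by
          rw [hσ0]
          intro h0
          rw [Equiv.swap_apply_eq_iff, Equiv.swap_apply_left] at h0
          exact hp h0
        obtain ⟨k, hk⟩ := Fin.exists_succ_eq.2 hs0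
        obtain ⟨i, hi⟩ : ∃ i : Fin b, σ i.succ = j := by
          have : σ.symm j ≠ 0 := fun h0 => hp (by rw [← hσ0, ← h0, Equiv.apply_symm_apply])
          obtain ⟨i, hi⟩ := Fin.exists_succ_eq.2 this
          exact ⟨i, by rw [hi, Equiv.apply_symm_apply]⟩
        have := mul_prod_map_eq_zero_of_mem hz
          (List.ofFn fun i : Fin b => (Fin.cons z (fun k => y k * u * z) : Fin (b + 1) → A)
            (Equiv.swap 0 j (σ i.succ))) (fun w hw => ?_) ?_ (u * y k)
        · rw [List.ofFn_succ, List.prod_cons, ← hk, Fin.cons_succ, ← mul_assoc]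
          rw [List.map_ofFn] at this
          simp only [← mul_assoc] at this ⊢
          simpa only [Function.comp_def, smul_zero] using congrArg (c σ • ·) this
        · obtain ⟨i, rfl⟩ := (List.mem_ofFn' _ _).1 hw
          dsimp only
          generalize Equiv.swap 0 j (σ i.succ) = q
          refine Fin.cases (Or.inl rfl) (fun q => Or.inr ⟨y q, rfl⟩) q
        · refine (List.mem_ofFn' _ _).2 ⟨i, ?_⟩
          dsimp only
          rw [hi, Equiv.swap_apply_right, Fin.cons_zero]
      · simp

/-- **Levitzki's theorem**: a prime P.I. ring has no nonzero nil right ideals. -/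
theorem eq_zero_of_nil_of_isPIAlgebra {A : Type} [Ring A] (hprime : IsPrimeRing' A)
    (htf : ∀ (n : ℤ) (x : A), n • x = 0 → n = 0 ∨ x = 0) (hPI : IsPIAlgebra A) {u : A}
    (hnil : ∀ x, IsNilpotent (u * x)) : u = 0 := by
  obtain ⟨b, -, c, hc, hid⟩ := hPI
  refine eq_zero_of_nil_of_interlaced_identity hprime htf b u hnil c hc fun x => ?_
  have := congrArg (u * ·) (hid fun i => x i * u)
  simpa only [Finset.mul_sum, mul_smul_comm, mul_zero] using this

open Polynomial in
/-- If `C a` annihilates every simple `A[X]`-module then `a` is nilpotent. -/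
theorem isNilpotent_of_forall_simple_polynomial {A : Type} [Ring A] (a : A)
    (h : ∀ (M : Ideal A[X]), M.IsMaximal → ∀ v : A[X] ⧸ M, (C a : A[X]) • v = 0) :
    IsNilpotent a := by
  have htop : Ideal.span {(1 - C a * X : A[X])} = ⊤ := by
    by_contra hne
    obtain ⟨M, hM, hle⟩ := Ideal.exists_le_maximal _ hne
    have h1 : (1 - C a * X : A[X]) ∈ M := hle (Ideal.subset_span rfl)
    have h2 : (C a * X : A[X]) ∈ M := by
      have := h M hM (Submodule.Quotient.mk X)
      rwa [← Submodule.Quotient.mk_smul, Submodule.Quotient.mk_eq_zero] at this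
    refine hM.ne_top ((Ideal.eq_top_iff_one _).2 ?_)
    simpa using M.add_mem h1 h2
  obtain ⟨g, hg⟩ := Ideal.mem_span_singleton'.1 (htop ▸ Submodule.mem_top : (1 : A[X]) ∈ _)
  have hcoeff : ∀ i, g.coeff i = a ^ i := by
    have hg' : g = 1 + g * C a * X := by
      rw [← hg, mul_sub, mul_one, mul_assoc]
      simp
    intro i
    induction i with
    | zero =>
      rw [hg']
      simp
    | succ i ih =>
      rw [hg', coeff_add, coeff_mul_X, coeff_mul_C, ih, pow_succ]
      simp [coeff_one]
  exact ⟨g.natDegree + 1, by rw [← hcoeff, coeff_eq_zero_of_natDegree_lt (Nat.lt_succ_self _)]⟩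

/-- An element annihilating all finite-dimensional simple modules acts nilpotently on every
finite-dimensional module. -/
theorem pow_finrank_smul_eq_zero {k A : Type} [Field k] [Ring A] [Algebra k A] {a : A}
    (ha : ∀ (V : Type) (_ : AddCommGroup V) (_ : Module k V) (_ : Module A V)
      (_ : IsScalarTower k A V), IsSimpleModule A V → Module.Finite k V → ∀ v : V, a • v = 0)
    (n : ℕ) (V : Type) [AddCommGroup V] [Module k V] [Module A V] [IsScalarTower k A V]
    [Module.Finite k V] (hn : Module.finrank k V ≤ n) (v : V) : a ^ n • v = 0 := by
  induction n generalizing V with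
  | zero =>
    have := Module.finrank_zero_iff.1 (Nat.le_zero.1 hn)
    exact Subsingleton.elim _ _
  | succ n ih =>
    cases subsingleton_or_nontrivial V
    · exact Subsingleton.elim _ _
    have : IsArtinian A V := isArtinian_of_tower k inferInstance
    obtain ⟨W, hW⟩ := IsAtomic.exists_atom (Submodule A V)
    have hWs : IsSimpleModule A W := isSimpleModule_iff_isAtom.2 hW
    have hfin : Module.Finite k W :=
      inferInstanceAs (Module.Finite k (W.restrictScalars k))
    have hfinQ : Module.Finite k (V ⧸ W) :=
      Module.Finite.of_surjective (W.mkQ.restrictScalars k) W.mkQ_surjective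
    have hpos : 0 < Module.finrank k W := by
      have := hWs.nontrivial
      exact Module.finrank_pos
    have hsum : Module.finrank k (V ⧸ W) + Module.finrank k W = Module.finrank k V :=
      (W.restrictScalars k).finrank_quotient_add_finrank
    have hq := ih (V ⧸ W) (by omega) (Submodule.Quotient.mk v)
    rw [← Submodule.Quotient.mk_smul, Submodule.Quotient.mk_eq_zero] at hq
    have := ha W _ _ _ inferInstance hWs hfin ⟨_, hq⟩
    rw [pow_succ', mul_smul]
    exact congrArg Subtype.val this

/-- A weak form of Hilbert's Nullstellensatz. -/
theorem nonempty_algHom_of_finiteType {k C : Type} [Field k] [IsAlgClosed k] [CommRing C]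
    [Nontrivial C] [Algebra k C] [Algebra.FiniteType k C] : Nonempty (C →ₐ[k] k) := by
  obtain ⟨m, hm⟩ := Ideal.exists_maximal C
  let := Ideal.Quotient.field m
  have := finite_of_finite_type_of_isJacobsonRing k (C ⧸ m)
  exact ⟨(IsAlgClosed.lift (R := k) (S := C ⧸ m) (M := k)).comp (Ideal.Quotient.mkₐ k m)⟩

/-- A matrix representation over an extension field of a finitely generated algebra over an
algebraically closed field `k` can be specialized to one over `k` without killing a given
element. -/
theorem exists_specialization_ne_zero {k A K : Type} [Field k] [IsAlgClosed k] [Ring A]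
    [Algebra k A] (haff : Algebra.FiniteType k A) [Field K] [Algebra k K] {n : ℕ}
    (φ : A →ₐ[k] Matrix (Fin n) (Fin n) K) {a : A} (ha : φ a ≠ 0) :
    ∃ ψ : A →ₐ[k] Matrix (Fin n) (Fin n) k, ψ a ≠ 0 := by
  obtain ⟨i, j, hij⟩ : ∃ i j, φ a i j ≠ 0 := by
    by_contra! h
    exact ha (Matrix.ext h)
  obtain ⟨s, hs⟩ := haff.out
  set T : Set K := insert (φ a i j)⁻¹
    (⋃ g ∈ s, Set.range fun p : Fin n × Fin n => φ g p.1 p.2) with hT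
  have hTfin : T.Finite :=
    (s.finite_toSet.biUnion fun _ _ => Set.finite_range _).insert _
  set C := Algebra.adjoin k T with hC
  have hmem : ∀ x p q, φ x p q ∈ C := by
    intro x
    have hx : x ∈ Algebra.adjoin k (s : Set A) := hs ▸ Algebra.mem_top
    induction hx using Algebra.adjoin_induction with
    | mem x hx =>
      intro p q
      exact Algebra.subset_adjoin (Set.mem_insert_of_mem _
        (Set.mem_biUnion hx ⟨(p, q), rfl⟩))
    | algebraMap r =>
      intro p q
      rw [AlgHom.commutes, Matrix.algebraMap_matrix_apply]
      split_ifs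
      · exact C.algebraMap_mem r
      · exact C.zero_mem
    | add x y _ _ hx hy =>
      intro p q
      rw [map_add]
      exact C.add_mem (hx p q) (hy p q)
    | mul x y _ _ hx hy =>
      intro p q
      rw [map_mul, Matrix.mul_apply]
      exact C.sum_mem fun r _ => C.mul_mem (hx p r) (hy r q)
  have hCfin : Algebra.FiniteType k C := by
    rw [← Subalgebra.fg_iff_finiteType]
    exact ⟨hTfin.toFinset, by rw [hTfin.coe_toFinset]⟩
  obtain ⟨χ⟩ : Nonempty (C →ₐ[k] k) := nonempty_algHom_of_finiteType
  refine ⟨AlgHom.ofLinearMap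
    { toFun := fun x => Matrix.of fun p q => χ ⟨φ x p q, hmem x p q⟩
      map_add' := fun x y => ?_
      map_smul' := fun r x => ?_ } ?_ fun x y => ?_, fun h => ?_⟩
  · ext p q
    simp only [Matrix.of_apply, Matrix.add_apply, ← map_add]
    congr 1
    ext
    simp
  · ext p q
    simp only [Matrix.of_apply, Matrix.smul_apply, RingHom.id_apply, ← map_smul]
    congr 1
    ext
    simp
  · ext p q
    simp only [LinearMap.coe_mk, AddHom.coe_mk, Matrix.of_apply]
    rw [Matrix.one_apply]
    split_ifs with hpq
    · rw [← map_one χ]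
      congr 1
      ext
      simp [hpq]
    · rw [← map_zero χ]
      congr 1
      ext
      simp [hpq]
  · ext p q
    simp only [LinearMap.coe_mk, AddHom.coe_mk, Matrix.of_apply, Matrix.mul_apply, ← map_mul,
      ← map_sum]
    congr 1
    ext
    simp [Matrix.mul_apply]
  · have h0 : χ ⟨φ a i j, hmem a i j⟩ = 0 := congrFun (congrFun h i) j
    have hinv : (φ a i j)⁻¹ ∈ C := Algebra.subset_adjoin (Set.mem_insert _ _)
    have h1 : (⟨φ a i j, hmem a i j⟩ : C) * ⟨_, hinv⟩ = 1 := Subtype.ext (mul_inv_cancel₀ hij)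
    have := congrArg χ h1
    rw [map_mul, h0, zero_mul, map_one] at this
    exact zero_ne_one this

/-- A multilinear identity on a set extends to its linear span. -/
theorem sum_smul_prod_eq_zero_of_mem_span {K B : Type*} [CommRing K] [Ring B] [Algebra K B]
    {b : ℕ} (c : Equiv.Perm (Fin b) → ℤ) {S : Set B}
    (hS : ∀ f : Fin b → B, (∀ i, f i ∈ S) →
      ∑ σ : Equiv.Perm (Fin b), c σ • (List.ofFn fun i => f (σ i)).prod = 0)
    (f : Fin b → B) (hf : ∀ i, f i ∈ Submodule.span K S) :
    ∑ σ : Equiv.Perm (Fin b), c σ • (List.ofFn fun i => f (σ i)).prod = 0 := by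
  let Φ : MultilinearMap K (fun _ : Fin b => B) B :=
    ∑ σ : Equiv.Perm (Fin b), c σ • (MultilinearMap.mkPiAlgebraFin K b B).domDomCongr σ
  have hΦ : ∀ g, Φ g = ∑ σ : Equiv.Perm (Fin b), c σ • (List.ofFn fun i => g (σ i)).prod := by
    intro g
    simp [Φ]
  let Ψ := Φ.compLinearMap fun _ => (Submodule.span K S).subtype
  have hΨ : Ψ = 0 := by
    refine MultilinearMap.ext_of_span_eq_top (γ := fun _ => S)
      (g := fun _ s => ⟨s.1, Submodule.subset_span s.2⟩) (fun i => ?_) fun s => ?_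
    · convert Submodule.span_span_coe_preimage (R := K) (s := S)
      ext ⟨x, hx⟩
      simp
    · simp only [Ψ, MultilinearMap.compLinearMap_apply, Submodule.subtype_apply, hΦ,
        zero_apply]
      exact hS _ fun i => (s i).2
  have := DFunLike.congr_fun hΨ fun i => ⟨f i, hf i⟩
  simpa [Ψ, hΦ] using this

/-- A product of operators shifting a chain of vectors down. -/
theorem prod_ofFn_shift_apply {F V : Type*} [Field F] [AddCommGroup V] [Module F V] {b : ℕ}
    (v : ℕ → V) (r : ℕ → Module.End F V)
    (hr : ∀ j < b, ∀ i ≤ b, r j (v i) = if i = j + 1 then v j else 0)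
    (n : ℕ) (hn : n ≤ b) (g : Fin n → ℕ) (hg : ∀ i, g i < b) :
    (List.ofFn fun i => r (g i)).prod (v n) = if ∀ i, g i = i then v 0 else 0 := by
  induction n with
  | zero => simp
  | succ n ih =>
    rw [List.ofFn_succ', List.concat_eq_append, List.prod_append, List.prod_singleton,
      Module.End.mul_apply, hr _ (hg _) _ hn]
    simp only [Fin.forall_fin_succ' (P := fun i => g i = i)]
    by_cases h : g (Fin.last n) = n
    · rw [if_pos (by omega), h, ih (by omega) _ fun i => hg _]
      simp
    · rw [if_neg (by omega), map_zero, if_neg]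
      rintro ⟨-, h'⟩
      exact h (by simpa using h')

/-- A set of operators that can shift any chain of `b + 1` linearly independent vectors satisfies
no multilinear identity of degree `b`. -/
theorem not_linearIndependent_of_identity {F V : Type*} [Field F] [CharZero F] [AddCommGroup V]
    [Module F V] {b : ℕ} {c : Equiv.Perm (Fin b) → ℤ} (hc : c ≠ 0) {S : Set (Module.End F V)}
    (hS : ∀ f : Fin b → Module.End F V, (∀ i, f i ∈ S) →
      ∑ σ : Equiv.Perm (Fin b), c σ • (List.ofFn fun i => f (σ i)).prod = 0)
    (hdense : ∀ (f : Module.End F V) (s : Finset V), ∃ r ∈ S, ∀ x ∈ s, f x = r x)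
    (v : Fin (b + 1) → V) : ¬ LinearIndependent F v := by
  intro hv
  classical
  obtain ⟨τ, hτ⟩ := Function.ne_iff.1 hc
  let v' : ℕ → V := fun i => if h : i < b + 1 then v ⟨i, h⟩ else 0
  have hex : ∀ j : ℕ, ∃ r ∈ S, ∀ i ≤ b, r (v' i) = if i = j + 1 then v' j else 0 := by
    intro j
    let B := Module.Basis.extend hv.linearIndepOn_id
    let f : Module.End F V := B.constr F fun x => if x.1 = v' (j + 1) then v' j else 0
    obtain ⟨r, hrS, hr⟩ := hdense f (Finset.univ.image v)
    refine ⟨r, hrS, fun i hi => ?_⟩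
    have hi' : i < b + 1 := by omega
    have hvi : v' i = v ⟨i, hi'⟩ := dif_pos hi'
    rw [hvi, ← hr _ (by simp)]
    have hB : B ⟨v ⟨i, hi'⟩, Module.Basis.subset_extend _ ⟨_, rfl⟩⟩ = v ⟨i, hi'⟩ := by
      simp [B]
    conv_lhs => rw [← hB]
    rw [Module.Basis.constr_basis]
    by_cases hj : j + 1 < b + 1
    · have : v' (j + 1) = v ⟨j + 1, hj⟩ := dif_pos hj
      simp only [this, hv.injective.eq_iff, Fin.mk.injEq]
    · have : v' (j + 1) = 0 := dif_neg hj
      rw [if_neg, if_neg (by omega)]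
      rw [this]
      exact hv.ne_zero _
  choose r hrS hr using hex
  have h0 : v' 0 ≠ 0 := by
    have : v' 0 = v 0 := dif_pos (Nat.succ_pos b)
    rw [this]
    exact hv.ne_zero _
  have key := hS (fun i => r (τ.symm i)) fun i => hrS _
  have := LinearMap.congr_fun key (v' b)
  rw [LinearMap.sum_apply, Finset.sum_eq_single τ] at this
  · rw [LinearMap.smul_apply, prod_ofFn_shift_apply (b := b) v' r (fun j _ => hr j) b le_rfl
      (fun i => ((τ.symm (τ i) : Fin b) : ℕ)) fun i => Fin.is_lt _, if_pos (by simp),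
      LinearMap.zero_apply, ← Int.cast_smul_eq_zsmul F, smul_eq_zero] at this
    rcases this with h | h
    · exact hτ (by exact_mod_cast h)
    · exact h0 h
  · intro σ _ hσ
    rw [LinearMap.smul_apply, prod_ofFn_shift_apply (b := b) v' r (fun j _ => hr j) b le_rfl
      (fun i => ((τ.symm (σ i) : Fin b) : ℕ)) fun i => Fin.is_lt _, if_neg, smul_zero]
    intro h
    refine hσ (Equiv.ext fun i => ?_)
    have := Fin.ext (h i)
    exact τ.symm_apply_eq.1 this
  · simp

/-- The density theorem for a set of operators with trivial commutant. -/
theorem exists_mem_span_range_eq {F V A : Type*} [Field F] [AddCommGroup V] [Module F V]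
    [Nontrivial V] [Ring A] (ρ : A →+* Module.End F V)
    (hsimple : ∀ W : Submodule F V, (∀ a, ∀ w ∈ W, ρ a w ∈ W) → W = ⊥ ∨ W = ⊤)
    (hcomm : ∀ g : Module.End F V, (∀ a, g * ρ a = ρ a * g) → ∃ c : F, ∀ v, g v = c • v)
    (f : Module.End F V) (s : Finset V) :
    ∃ r ∈ Submodule.span F (Set.range ρ), ∀ x ∈ s, f x = r x := by
  let R := Algebra.adjoin F (Set.range ρ)
  have hρ : ∀ a, ρ a ∈ R := fun a => Algebra.subset_adjoin ⟨a, rfl⟩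
  have hR : Subalgebra.toSubmodule R = Submodule.span F (Set.range ρ) := by
    rw [Algebra.adjoin_eq_span]
    congr 1
    exact congrArg _ (Submonoid.closure_eq (MonoidHom.mrange (ρ : A →* Module.End F V)))
  have hs : IsSimpleModule R V := by
    rw [isSimpleModule_iff]
    refine { exists_pair_ne := ⟨⊥, ⊤, bot_ne_top⟩, eq_bot_or_eq_top := fun W => ?_ }
    rcases hsimple (W.restrictScalars F) fun a w hw => W.smul_mem ⟨ρ a, hρ a⟩ hw with h | h
    · left
      exact (Submodule.restrictScalars_eq_bot_iff ..).1 h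
    · right
      exact (Submodule.restrictScalars_eq_top_iff ..).1 h
  have hlin : ∀ g : Module.End R V, ∃ c : F, ∀ v, g v = c • v := by
    intro g
    refine hcomm (g.restrictScalars F) fun a => LinearMap.ext fun v => ?_
    exact g.map_smul ⟨ρ a, hρ a⟩ v
  let f' : Module.End (Module.End R V) V :=
    { toFun := f
      map_add' := f.map_add
      map_smul' := fun g v => by
        obtain ⟨c, hc⟩ := hlin g
        simp only [Module.End.smul_def, hc, map_smul, RingHom.id_apply] }
  obtain ⟨r, hr⟩ := jacobson_density f' s
  exact ⟨r, hR ▸ r.2, hr⟩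

/-- Kaplansky's bound for an algebra of operators with trivial commutant. -/
theorem finite_and_finrank_le_of_identity {F V A : Type} [Field F] [CharZero F] [AddCommGroup V]
    [Module F V] [Nontrivial V] [Ring A] (ρ : A →+* Module.End F V)
    (hsimple : ∀ W : Submodule F V, (∀ a, ∀ w ∈ W, ρ a w ∈ W) → W = ⊥ ∨ W = ⊤)
    (hcomm : ∀ g : Module.End F V, (∀ a, g * ρ a = ρ a * g) → ∃ c : F, ∀ v, g v = c • v)
    {b : ℕ} (hb : SatisfiesMultilinearIdentity A b) :
    Module.Finite F V ∧ Module.finrank F V ≤ b := by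
  obtain ⟨c, hc, hid⟩ := hb
  have hspan := sum_smul_prod_eq_zero_of_mem_span (K := F) (S := Set.range ρ) c fun f hf => by
    choose a ha using hf
    have := congrArg ρ (hid a)
    simpa only [map_sum, map_zsmul, map_list_prod, List.map_ofFn, Function.comp_def, ha,
      map_zero] using this
  have hrank : Module.rank F V ≤ b := by
    refine rank_le fun s hs => ?_
    by_contra! hlt
    obtain ⟨t, hts, ht⟩ := Finset.exists_subset_card_eq (Nat.succ_le_of_lt hlt)
    refine not_linearIndependent_of_identity hc hspan
      (exists_mem_span_range_eq ρ hsimple hcomm)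
      (fun i => ((t.equivFin.symm (Fin.cast ht.symm i) : t) : V)) ?_
    have h1 : LinearIndependent F (fun i : t => (i : V)) :=
      hs.comp (fun i : t => (⟨i.1, hts i.2⟩ : s)) fun x y hxy =>
        Subtype.ext (congrArg (fun z : s => (z : V)) hxy)
    exact h1.comp _ (t.equivFin.symm.injective.comp (Fin.cast_injective _))
  have hfin : Module.Finite F V :=
    Module.rank_lt_aleph0_iff.1 (hrank.trans_lt (Cardinal.natCast_lt_aleph0))
  exact ⟨hfin, Module.finrank_le_of_rank_le hrank⟩

/-- A simple module carries an action of a maximal subfield of its endomorphism ring, and the joint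
commutant is that field. -/
theorem exists_field_commutant_eq {k R V : Type} [Field k] [Ring R] [Algebra k R]
    [AddCommGroup V] [Module k V] [Module R V] [IsScalarTower k R V] [IsSimpleModule R V] :
    ∃ (F : Type) (_ : Field F) (_ : Algebra k F) (_ : Module F V) (_ : IsScalarTower k F V)
      (_ : SMulCommClass R F V),
      ∀ g : V →+ V, (∀ (r : R) v, g (r • v) = r • g v) → (∀ (c : F) v, g (c • v) = c • g v) →
        ∃ c : F, ∀ v, g v = c • v := by
  classical
  let D := Module.End R V
  obtain ⟨S, -, hS⟩ := zorn_subset_nonempty {S : Set D | ∀ x ∈ S, ∀ y ∈ S, x * y = y * x}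
    (fun c hc hchain _ => ⟨⋃₀ c, fun x ⟨s, hs, hx⟩ y ⟨t, ht, hy⟩ => by
      rcases hchain.total hs ht with h | h
      · exact hc ht x (h hx) y hy
      · exact hc hs x hx y (h hy), fun s hs => Set.subset_sUnion_of_mem hs⟩) ∅ (by simp)
  have hmem : ∀ x : D, (∀ y ∈ S, y * x = x * y) → x ∈ S := by
    intro x hx
    refine hS.2 (y := insert x S) ?_ (Set.subset_insert x S) (Set.mem_insert x S)
    rintro y (rfl | hy) z (rfl | hz)
    · rfl
    · exact (hx z hz).symm
    · exact hx y hy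
    · exact hS.1 y hy z hz
  let E : Subalgebra k D := Subalgebra.centralizer k S
  have hE : ∀ x : D, x ∈ E ↔ ∀ y ∈ S, y * x = x * y := fun x => Subalgebra.mem_centralizer_iff k
  have hcomm : ∀ x y : E, x * y = y * x := fun x y =>
    Subtype.ext ((hE y).1 y.2 x (hmem _ ((hE x).1 x.2)))
  have hfield : IsField E :=
    { exists_pair_ne := ⟨0, 1, zero_ne_one⟩
      mul_comm := hcomm
      mul_inv_cancel := by
        rintro ⟨x, hx⟩ hx0
        have hx0' : x ≠ 0 := fun h => hx0 (Subtype.ext h)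
        refine ⟨⟨x⁻¹, (hE _).2 fun y hy => ?_⟩, Subtype.ext (mul_inv_cancel₀ hx0')⟩
        exact (show Commute y x from (hE x).1 hx y hy).inv_right₀ }
  let : Field E := hfield.toField
  refine ⟨E, inferInstance, Subalgebra.algebra E, Subalgebra.moduleLeft E, ?_, ?_, ?_⟩
  · exact ⟨fun r x v => rfl⟩
  · exact ⟨fun r x v => (x.1.map_smul r v).symm⟩
  · intro g hg hgE
    let g' : D := { g with map_smul' := hg }
    refine ⟨⟨g', (hE _).2 fun y hy => ?_⟩, fun v => rfl⟩
    refine LinearMap.ext fun v => ?_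
    exact (hgE ⟨y, (hE y).2 fun z hz => hS.1 z hz y hy⟩ v).symm

/-- An element annihilating all finite-dimensional simple modules is nilpotent under every
finite-dimensional representation. -/
theorem map_pow_eq_zero_of_finrank_le {k A : Type} [Field k] [Ring A] [Algebra k A] {a : A}
    (ha : ∀ (V : Type) (_ : AddCommGroup V) (_ : Module k V) (_ : Module A V)
      (_ : IsScalarTower k A V), IsSimpleModule A V → Module.Finite k V → ∀ v : V, a • v = 0)
    {W : Type} [AddCommGroup W] [Module k W] [Module.Finite k W] (ψ : A →ₐ[k] Module.End k W)
    {n : ℕ} (hn : Module.finrank k W ≤ n) : ψ (a ^ n) = 0 := by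
  let : Module A W := Module.compHom W (ψ : A →+* Module.End k W)
  have hsmul : ∀ (x : A) (w : W), x • w = ψ x w := fun _ _ => rfl
  have : IsScalarTower k A W := ⟨fun r x w => by simp [hsmul]⟩
  exact LinearMap.ext fun w => pow_finrank_smul_eq_zero ha n W hn w

open Polynomial in
/-- In an affine P.I. algebra, an element annihilating all finite-dimensional simple modules is
nilpotent. -/
theorem isNilpotent_of_forall_finite_simple {k A : Type} [Field k] [IsAlgClosed k] [CharZero k]
    [Ring A] [Algebra k A] (haff : Algebra.FiniteType k A) (hPI : IsPIAlgebra A) {a : A}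
    (ha : ∀ (V : Type) (_ : AddCommGroup V) (_ : Module k V) (_ : Module A V)
      (_ : IsScalarTower k A V), IsSimpleModule A V → Module.Finite k V → ∀ v : V, a • v = 0) :
    IsNilpotent a := by
  obtain ⟨b, -, hb⟩ := hPI
  suffices h : IsNilpotent (a ^ b) by
    obtain ⟨n, hn⟩ := h
    exact ⟨b * n, by rw [pow_mul, hn]⟩
  refine isNilpotent_of_forall_simple_polynomial _ fun M hM => ?_
  have hs : IsSimpleModule A[X] (A[X] ⧸ M) := isSimpleModule_iff_isCoatom.2 hM.out
  obtain ⟨F, _, _, _, _, _, hF⟩ := exists_field_commutant_eq (k := k) (R := A[X]) (V := A[X] ⧸ M)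
  have := hs.nontrivial
  set V := A[X] ⧸ M
  have : CharZero F := charZero_of_injective_algebraMap (algebraMap k F).injective
  let ρ : A →ₐ[k] Module.End F V := (Algebra.lsmul k F V).comp (CAlgHom (R := k) (A := A))
  have hρ : ∀ x v, ρ x v = (C x : A[X]) • v := fun _ _ => rfl
  obtain ⟨t, ht⟩ := hF (DistribSMul.toAddMonoidHom V (X : A[X]))
    (fun p v => by
      change (X : A[X]) • p • v = p • (X : A[X]) • v
      rw [smul_smul, smul_smul, X_mul])
    (fun c v => smul_comm _ _ _)
  replace ht : ∀ v, (X : A[X]) • v = t • v := ht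
  obtain ⟨hfin, hrank⟩ := finite_and_finrank_le_of_identity (F := F) (V := V)
    (ρ : A →+* Module.End F V)
    (fun W hW => by
      have hWp : ∀ (p : A[X]), ∀ w ∈ W, p • w ∈ W := by
        intro p
        induction p using Polynomial.induction_on with
        | C x => exact fun w hw => hW x w hw
        | add p q hp hq =>
          intro w hw
          rw [add_smul]
          exact W.add_mem (hp w hw) (hq w hw)
        | monomial n x ih =>
          intro w hw
          rw [pow_succ, ← mul_assoc, mul_smul, ht]
          exact ih _ (W.smul_mem t hw)
      let W' : Submodule A[X] V := { W with smul_mem' := fun p w hw => hWp p w hw }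
      have hW' : ∀ w, w ∈ W' ↔ w ∈ W := fun _ => Iff.rfl
      rcases eq_bot_or_eq_top W' with h | h
      · left
        ext w
        rw [← hW', h, Submodule.mem_bot, Submodule.mem_bot]
      · right
        ext w
        rw [← hW', h]
        simp)
    (fun g hg => by
      refine hF g.toAddMonoidHom (fun p => ?_) fun c v => g.map_smul c v
      simp only [LinearMap.toAddMonoidHom_coe]
      induction p using Polynomial.induction_on with
      | C x => exact fun v => LinearMap.congr_fun (hg x) v
      | add p q hp hq =>
        intro v
        rw [add_smul, map_add, hp, hq, add_smul]
      | monomial n x ih =>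
        intro v
        rw [pow_succ, ← mul_assoc, mul_smul, ih, ht, mul_smul (C x * X ^ n), ht, map_smul]) hb
  suffices h : ρ (a ^ b) = 0 by
    intro v
    rw [← hρ, h, LinearMap.zero_apply]
  by_contra hne
  let e : Module.End F V ≃ₐ[k] _ :=
    (LinearMap.toMatrixAlgEquiv (Module.finBasis F V)).restrictScalars k
  obtain ⟨ψ, hψ⟩ := exists_specialization_ne_zero haff (e.toAlgHom.comp ρ) (a := a ^ b)
    (fun h => hne (e.injective (by rw [map_zero]; exact h)))
  have := map_pow_eq_zero_of_finrank_le ha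
    ((Matrix.toLinAlgEquiv' : _ ≃ₐ[k] _).toAlgHom.comp ψ) (n := b) (by simpa using hrank)
  exact hψ (Matrix.toLinAlgEquiv'.injective (by rw [map_zero]; exact this))

/-- In an affine prime P.I. algebra, the finite-dimensional simple modules separate elements. -/
theorem eq_zero_of_forall_finite_simple {k A : Type} [Field k] [IsAlgClosed k] [CharZero k]
    [Ring A] [Algebra k A] (haff : Algebra.FiniteType k A) (hprime : IsPrimeRing' A)
    (hPI : IsPIAlgebra A) {a : A}
    (ha : ∀ (V : Type) (_ : AddCommGroup V) (_ : Module k V) (_ : Module A V)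
      (_ : IsScalarTower k A V), IsSimpleModule A V → Module.Finite k V → ∀ v : V, a • v = 0) :
    a = 0 := by
  refine eq_zero_of_nil_of_isPIAlgebra hprime (fun n x h => ?_) hPI fun x =>
    isNilpotent_of_forall_finite_simple haff hPI fun V _ _ _ _ h1 h2 v => ?_
  · rw [← Int.cast_smul_eq_zsmul k] at h
    exact (smul_eq_zero.1 h).imp_left fun h => by exact_mod_cast h
  · rw [mul_smul]
    exact ha V _ _ _ inferInstance h1 h2 _

/-- The data needed to apply the density theorem to a finite-dimensional simple module over an
algebraically closed field. -/
theorem IsSimpleModule.lsmul_simple_and_commutant {k A V : Type} [Field k] [IsAlgClosed k] [Ring A]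
    [Algebra k A] [AddCommGroup V] [Module k V] [Module A V] [IsScalarTower k A V]
    [IsSimpleModule A V] [Module.Finite k V] :
    (∀ W : Submodule k V, (∀ a : A, ∀ w ∈ W, Algebra.lsmul k k V a w ∈ W) → W = ⊥ ∨ W = ⊤) ∧
    ∀ g : Module.End k V, (∀ a : A, g * Algebra.lsmul k k V a = Algebra.lsmul k k V a * g) →
      ∃ c : k, ∀ v, g v = c • v := by
  constructor
  · intro W hW
    let W' : Submodule A V := { W with smul_mem' := fun p w hw => hW p w hw }
    have hW' : W'.restrictScalars k = W := rfl
    rcases eq_bot_or_eq_top W' with h | h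
    · left
      rw [← hW', h, Submodule.restrictScalars_bot]
    · right
      rw [← hW', h, Submodule.restrictScalars_top]
  · intro g hg
    let g' : Module.End A V :=
      { g with map_smul' := fun a v => LinearMap.congr_fun (hg a) v }
    obtain ⟨c, hc⟩ := (IsSimpleModule.algebraMap_end_bijective_of_isAlgClosed k).2 g'
    exact ⟨c, fun v => (LinearMap.congr_fun hc v).symm⟩

/-- **Burnside's theorem**: an algebra over an algebraically closed field acts on a
finite-dimensional simple module by all linear endomorphisms. -/
theorem IsSimpleModule.lsmul_surjective_s1 {k A V : Type} [Field k] [IsAlgClosed k] [Ring A]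
    [Algebra k A] [AddCommGroup V] [Module k V] [Module A V] [IsScalarTower k A V]
    [IsSimpleModule A V] [Module.Finite k V] :
    Function.Surjective (Algebra.lsmul k k V : A →ₐ[k] Module.End k V) := by
  intro f
  have := IsSimpleModule.nontrivial A V
  obtain ⟨h1, h2⟩ := IsSimpleModule.lsmul_simple_and_commutant (k := k) (A := A) (V := V)
  obtain ⟨s, hs⟩ := Module.Finite.fg_top (R := k) (M := V)
  obtain ⟨r, hr, hrf⟩ := exists_mem_span_range_eq
    ((Algebra.lsmul k k V : A →ₐ[k] Module.End k V) : A →+* Module.End k V) h1 h2 f s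
  have hspan : r ∈ LinearMap.range (Algebra.lsmul k k V : A →ₐ[k] Module.End k V).toLinearMap := by
    refine Submodule.span_le.2 ?_ hr
    rintro _ ⟨a, rfl⟩
    exact ⟨a, rfl⟩
  obtain ⟨a, ha⟩ := hspan
  refine ⟨a, ?_⟩
  refine LinearMap.ext_on hs fun x hx => ?_
  rw [hrf x hx]
  exact LinearMap.congr_fun ha x

/-- Evaluation of noncommutative polynomials commutes with ring homomorphisms. -/
theorem map_freeAlgebra_lift {A B : Type*} [Ring A] [Ring B] (φ : A →+* B) (f : ℕ → A)
    (p : FreeAlgebra ℤ ℕ) : φ (FreeAlgebra.lift ℤ f p) = FreeAlgebra.lift ℤ (φ ∘ f) p := by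
  have : (φ.toIntAlgHom).comp (FreeAlgebra.lift ℤ f) = FreeAlgebra.lift ℤ (φ ∘ f) := by
    ext i
    simp
  exact AlgHom.congr_fun this p

/-- Polynomial identities pass to homomorphic images. -/
theorem IsPolyIdentity.of_surjective {A B : Type} [Ring A] [Ring B] {p : FreeAlgebra ℤ ℕ}
    (h : IsPolyIdentity A p) (φ : A →+* B) (hφ : Function.Surjective φ) : IsPolyIdentity B p := by
  intro f
  choose g hg using fun i => hφ (f i)
  have : φ ∘ g = f := funext hg
  rw [← this, ← map_freeAlgebra_lift, h g, map_zero]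

/-- Polynomial identities pass to subrings. -/
theorem IsPolyIdentity.of_injective {A B : Type} [Ring A] [Ring B] {p : FreeAlgebra ℤ ℕ}
    (h : IsPolyIdentity B p) (φ : A →+* B) (hφ : Function.Injective φ) : IsPolyIdentity A p := by
  intro f
  rw [← map_eq_zero_iff φ hφ, map_freeAlgebra_lift]
  exact h _

/-- Block-diagonal embedding of a product of two matrix rings. -/
def Matrix.fromBlocksDiagonalRingHom (m n R : Type*) [Fintype m] [Fintype n] [DecidableEq m]
    [DecidableEq n] [CommRing R] :
    Matrix m m R × Matrix n n R →+* Matrix (m ⊕ n) (m ⊕ n) R where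
  toFun M := Matrix.fromBlocks M.1 0 0 M.2
  map_one' := Matrix.fromBlocks_one
  map_mul' M N := by simp [Matrix.fromBlocks_multiply]
  map_zero' := Matrix.fromBlocks_zero
  map_add' M N := by simp [Matrix.fromBlocks_add]

/-- Identities of larger matrices are identities of smaller matrices. -/
theorem IsPolyIdentity.matrix_of_le {R : Type} [CommRing R] {p : FreeAlgebra ℤ ℕ} {c d : ℕ}
    (hcd : c ≤ d) (h : IsPolyIdentity (Matrix (Fin d) (Fin d) R) p) :
    IsPolyIdentity (Matrix (Fin c) (Fin c) R) p := by
  let e : Fin c ⊕ Fin (d - c) ≃ Fin d := finSumFinEquiv.trans (finCongr (by omega))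
  have h1 : IsPolyIdentity (Matrix (Fin c) (Fin c) R × Matrix (Fin (d - c)) (Fin (d - c)) R) p := by
    refine h.of_injective (((Matrix.reindexAlgEquiv R R e : _ →+* _)).comp
      (Matrix.fromBlocksDiagonalRingHom (Fin c) (Fin (d - c)) R)) ?_
    refine (Matrix.reindexAlgEquiv R R e).injective.comp fun M N hMN => ?_
    have := Matrix.fromBlocks_inj.1 hMN
    exact Prod.ext this.1 this.2.2.2
  exact h1.of_surjective (RingHom.fst _ _) Prod.fst_surjective

/-- The Capelli polynomial in `m` alternating variables. -/
noncomputable def capelliPoly (m : ℕ) : FreeAlgebra ℤ ℕ :=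
  ∑ σ : Equiv.Perm (Fin m), (Equiv.Perm.sign σ : ℤ) •
    (List.ofFn fun i : Fin m => FreeAlgebra.ι ℤ (3 * (i : ℕ)) *
      FreeAlgebra.ι ℤ (3 * (σ i : ℕ) + 1) * FreeAlgebra.ι ℤ (3 * (i : ℕ) + 2)).prod

theorem lift_capelliPoly {A : Type*} [Ring A] (m : ℕ) (f : ℕ → A) :
    FreeAlgebra.lift ℤ f (capelliPoly m) = ∑ σ : Equiv.Perm (Fin m), (Equiv.Perm.sign σ : ℤ) •
      (List.ofFn fun i : Fin m => f (3 * (i : ℕ)) * f (3 * (σ i : ℕ) + 1) *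
        f (3 * (i : ℕ) + 2)).prod := by
  simp [capelliPoly, map_sum, map_list_prod, List.map_ofFn, Function.comp_def]

/-- The Capelli polynomial vanishes on algebras spanned by fewer elements than its number of
alternating variables. -/
theorem isPolyIdentity_capelliPoly {R A ι : Type} [CommRing R] [Ring A] [Algebra R A] [Fintype ι]
    (B : Module.Basis ι R A) {m : ℕ} (hm : Fintype.card ι < m) :
    IsPolyIdentity A (capelliPoly m) := by
  intro f
  let Φ : MultilinearMap R (fun _ : Fin m => A) A :=
    (MultilinearMap.mkPiAlgebraFin R m A).compLinearMap fun i =>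
      (LinearMap.mulRight R (f (3 * (i : ℕ) + 2))).comp (LinearMap.mulLeft R (f (3 * (i : ℕ))))
  have hΦ : MultilinearMap.alternatization Φ = 0 := by
    refine Module.Basis.ext_alternating B fun v hv => ?_
    have := Fintype.card_le_of_injective v hv
    rw [Fintype.card_fin] at this
    omega
  have := DFunLike.congr_fun hΦ fun i : Fin m => f (3 * (i : ℕ) + 1)
  rw [MultilinearMap.alternatization_apply] at this
  rw [lift_capelliPoly, ← AlternatingMap.zero_apply (R := R) (M := A) (N := A) (ι := Fin m), ← this]
  refine Finset.sum_congr rfl fun σ _ => ?_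
  simp [Φ, MultilinearMap.domDomCongr_apply, Units.smul_def]

theorem not_isPolyIdentity_capelliPoly {k : Type} [Field k] {c m : ℕ} (hc : 0 < c)
    (hm : m ≤ c * c) : ¬ IsPolyIdentity (Matrix (Fin c) (Fin c) k) (capelliPoly m) := by
  intro h
  obtain ⟨q⟩ : Nonempty (Fin m ↪ Fin c × Fin c) :=
    Function.Embedding.nonempty_of_card_le (by simpa using hm)
  let o : Fin c := ⟨0, hc⟩
  let E : Fin c → Fin c → Matrix (Fin c) (Fin c) k := fun i j => Matrix.single i j 1
  let f : ℕ → Matrix (Fin c) (Fin c) k := fun n =>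
    if hn : n / 3 < m then
      if n % 3 = 0 then E o (q ⟨n / 3, hn⟩).1
      else if n % 3 = 1 then E (q ⟨n / 3, hn⟩).1 (q ⟨n / 3, hn⟩).2
      else E (q ⟨n / 3, hn⟩).2 o
    else 0
  have hf0 : ∀ i : Fin m, f (3 * (i : ℕ)) = E o (q i).1 := by
    intro i
    have h1 : 3 * (i : ℕ) / 3 = i := by omega
    simp [f, h1]
  have hf1 : ∀ i : Fin m, f (3 * (i : ℕ) + 1) = E (q i).1 (q i).2 := by
    intro i
    have h1 : (3 * (i : ℕ) + 1) / 3 = i := by omega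
    have h2 : (3 * (i : ℕ) + 1) % 3 = 1 := by omega
    simp [f, h1, h2]
  have hf2 : ∀ i : Fin m, f (3 * (i : ℕ) + 2) = E (q i).2 o := by
    intro i
    have h1 : (3 * (i : ℕ) + 2) / 3 = i := by omega
    have h2 : (3 * (i : ℕ) + 2) % 3 = 2 := by omega
    simp [f, h1, h2]
  have hE : ∀ i j : Fin m, E o (q i).1 * E (q j).1 (q j).2 * E (q i).2 o =
      if j = i then E o o else 0 := by
    intro i j
    by_cases hij : j = i
    · subst hij
      simp [E]
    · rw [if_neg hij]
      by_cases h1 : (q i).1 = (q j).1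
      · have h2 : (q j).2 ≠ (q i).2 := fun h2 => hij (q.injective (Prod.ext h1.symm h2))
        simp only [E]
        rw [h1, Matrix.single_mul_single_same, Matrix.single_mul_single_of_ne _ _ _ _ h2]
      · simp only [E]
        rw [Matrix.single_mul_single_of_ne _ _ _ _ h1, zero_mul]
  have key := h f
  rw [lift_capelliPoly, Finset.sum_eq_single 1] at key
  · simp only [hf0, hf1, hf2, hE, Equiv.Perm.one_apply, if_true, Equiv.Perm.sign_one] at key
    have hE' : ∀ n : ℕ, (E o o) ^ n * E o o = E o o := by
      intro n
      induction n with
      | zero => simp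
      | succ n ih =>
        rw [pow_succ, mul_assoc]
        simpa [E] using ih
    rw [List.ofFn_const, List.prod_replicate, Units.val_one, one_smul] at key
    have hzero : E o o = 0 := by rw [← hE' m, key, zero_mul]
    have := congrFun (congrFun hzero o) o
    simp [E] at this
  · intro σ _ hσ
    obtain ⟨i, hi⟩ : ∃ i, σ i ≠ i := by
      by_contra! hall
      exact hσ (Equiv.ext hall)
    rw [List.prod_eq_zero, smul_zero]
    refine (List.mem_ofFn' _ _).2 ⟨i, ?_⟩
    dsimp only
    rw [hf0, hf1, hf2, hE, if_neg hi]
  · simp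

/-- If all identities of `e × e` matrices hold for `c × c` matrices over a field, then `c ≤ e`. -/
theorem le_of_degLE_matrix {k : Type} [Field k] {c e : ℕ}
    (h : DegLE (Matrix (Fin c) (Fin c) k) e) : c ≤ e := by
  by_contra! hlt
  refine not_isPolyIdentity_capelliPoly (k := k) (c := c) (m := e * e + 1) (by omega)
    (by nlinarith) (h _ fun R _ => ?_)
  exact isPolyIdentity_capelliPoly (Matrix.stdBasis R (Fin e) (Fin e)) (by simp)

/-- The endomorphism ring of a finite-dimensional space is a matrix ring. -/
theorem nonempty_end_ringEquiv_matrix (k V : Type) [Field k] [AddCommGroup V] [Module k V]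
    [Module.Finite k V] : Nonempty (Module.End k V ≃+*
      Matrix (Fin (Module.finrank k V)) (Fin (Module.finrank k V)) k) :=
  ⟨(LinearMap.toMatrixAlgEquiv (Module.finBasis k V)).toRingEquiv⟩

/-- For an affine prime P.I. algebra `A` over an algebraically closed
field `k` of characteristic zero, `deg A` is the supremum of `dim_k S` over all
finite-dimensional irreducible `A`-modules `S`. -/
theorem hasDeg_sSup_finrank_simple
    (k A : Type) [Field k] [IsAlgClosed k] [CharZero k] [Ring A] [Algebra k A]
    (haff : Algebra.FiniteType k A) (hprime : IsPrimeRing' A) (hPI : IsPIAlgebra A) :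
    HasDeg A
      (sSup {c : ℕ | ∃ (V : Type) (_ : AddCommGroup V) (_ : Module k V) (_ : Module A V)
        (_ : IsScalarTower k A V),
        IsSimpleModule A V ∧ Module.Finite k V ∧ c = Module.finrank k V}) := by
  set T := {c : ℕ | ∃ (V : Type) (_ : AddCommGroup V) (_ : Module k V) (_ : Module A V)
    (_ : IsScalarTower k A V),
    IsSimpleModule A V ∧ Module.Finite k V ∧ c = Module.finrank k V} with hT
  have hbdd : BddAbove T := by
    obtain ⟨b, -, hb⟩ := hPI
    refine ⟨b, ?_⟩
    rintro _ ⟨V, _, _, _, _, _, _, rfl⟩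
    have := IsSimpleModule.nontrivial A V
    obtain ⟨h1, h2⟩ := IsSimpleModule.lsmul_simple_and_commutant (k := k) (A := A) (V := V)
    exact (finite_and_finrank_le_of_identity
      ((Algebra.lsmul k k V : A →ₐ[k] Module.End k V) : A →+* Module.End k V) h1 h2 hb).2
  constructor
  · intro p hp f
    refine eq_zero_of_forall_finite_simple (k := k) haff hprime hPI
      fun V _ _ _ _ hsimple hfin v => ?_
    obtain ⟨e⟩ := nonempty_end_ringEquiv_matrix k V
    have hc : Module.finrank k V ≤ sSup T := le_csSup hbdd ⟨V, _, _, _, ‹_›, hsimple, hfin, rfl⟩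
    have hV : IsPolyIdentity (Module.End k V) p :=
      ((hp k).matrix_of_le hc).of_injective (e : _ →+* _) e.injective
    have := map_freeAlgebra_lift
      ((Algebra.lsmul k k V : A →ₐ[k] Module.End k V) : A →+* Module.End k V) f p
    rw [hV] at this
    exact LinearMap.congr_fun this v
  · intro e he
    refine csSup_le' ?_
    rintro _ ⟨V, _, _, _, _, _, _, rfl⟩
    obtain ⟨ε⟩ := nonempty_end_ringEquiv_matrix k V
    refine le_of_degLE_matrix (k := k) fun p hp => (he p hp).of_surjective
      ((ε : _ →+* _).comp
        ((Algebra.lsmul k k V : A →ₐ[k] Module.End k V) : A →+* Module.End k V)) ?_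
    exact ε.surjective.comp IsSimpleModule.lsmul_surjective_s1
end

section
/- Let k be a field, let q ∈ k be a primitive m-th root of unity, and let J = (h_{i,j}) be a skew-symmetric n×n matrix with integer coefficients. Then the quasipolynomial Laurent algebra k_J[x_1^{±1}, ..., x_n^{±1}] is an Azumaya algebra over its center. -/
open scoped BigOperators TensorProduct

/-- The left-and-right multiplication map `A ⊗[C] Aᵐᵒᵖ →ₗ[C] End_C A`,
`a ⊗ b ↦ (x ↦ a * x * b.unop)`. -/
noncomputable def mulLeftRightMap (C A : Type) [CommRing C] [Ring A] [Algebra C A] :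
    A ⊗[C] Aᵐᵒᵖ →ₗ[C] Module.End C A :=
  TensorProduct.lift
    (LinearMap.mk₂ C (fun a b => (LinearMap.mulLeft C a).comp (LinearMap.mulRight C b.unop))
      (fun _ _ _ => by ext x; simp [add_mul])
      (fun _ _ _ => by ext x; simp [smul_mul_assoc])
      (fun _ _ _ => by ext x; simp [mul_add])
      (fun _ _ _ => by ext x; simp [mul_smul_comm]))

/-- A ring `A` is Azumaya over its center `Z(A)` if `A` is a finitely generated faithful
projective `Z(A)`-module and the natural map `A ⊗_{Z(A)} Aᵐᵒᵖ → End_{Z(A)}(A)` is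
bijective. -/
def IsAzumayaOverCenter (A : Type) [Ring A] : Prop :=
  Module.Finite (Subring.center A) A ∧ Module.Projective (Subring.center A) A ∧
    FaithfulSMul (Subring.center A) A ∧
    Function.Bijective (mulLeftRightMap (Subring.center A) A)

/-- Defining relations of the quasipolynomial Laurent algebra
`k_J[x_1^{±1}, ..., x_n^{±1}]`: the generators `Sum.inl i` play the role of `x_i`, the
generators `Sum.inr i` play the role of `x_i⁻¹`, and `x_i x_j = q^{h i j} x_j x_i`
for `i < j`. -/
inductive QLaurentRel (k : Type) [Field k] (q : k) (n : ℕ) (h : Fin n → Fin n → ℤ) :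
    FreeAlgebra k (Fin n ⊕ Fin n) → FreeAlgebra k (Fin n ⊕ Fin n) → Prop
  | mul_inv (i : Fin n) :
      QLaurentRel k q n h (FreeAlgebra.ι k (Sum.inl i) * FreeAlgebra.ι k (Sum.inr i)) 1
  | inv_mul (i : Fin n) :
      QLaurentRel k q n h (FreeAlgebra.ι k (Sum.inr i) * FreeAlgebra.ι k (Sum.inl i)) 1
  | comm (i j : Fin n) (hij : i < j) :
      QLaurentRel k q n h
        (FreeAlgebra.ι k (Sum.inl i) * FreeAlgebra.ι k (Sum.inl j))
        ((q ^ (h i j) : k) • (FreeAlgebra.ι k (Sum.inl j) * FreeAlgebra.ι k (Sum.inl i)))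

/-- The quasipolynomial Laurent algebra `k_J[x_1^{±1}, ..., x_n^{±1}]`. -/
abbrev QLaurent (k : Type) [Field k] (q : k) (n : ℕ) (h : Fin n → Fin n → ℤ) : Type :=
  RingQuot (QLaurentRel k q n h)

section SpanningUnits

variable {A : Type} [Ring A] {U : Subgroup Aˣ}

variable {k : Type} [Field k] [Algebra k A]

theorem mem_center_of_span
    (hspan : Submodule.span k ((fun u : Aˣ => (u : A)) '' U) = ⊤) {z : A}
    (hz : ∀ u ∈ U, (u : A) * z = z * u) : z ∈ Subring.center A := by
  rw [Subring.mem_center_iff]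
  intro a
  have ha : a ∈ Submodule.span k ((fun u : Aˣ => (u : A)) '' U) := hspan ▸ Submodule.mem_top
  induction ha using Submodule.span_induction with
  | mem x hx => obtain ⟨u, hu, rfl⟩ := hx; exact hz u hu
  | zero => simp
  | add x y _ _ hx hy => rw [add_mul, mul_add, hx, hy]
  | smul c x _ hx => rw [smul_mul_assoc, mul_smul_comm, hx]

theorem sum_out_mul {H M : Type*} [Group H] [AddCommMonoid M]
    [Fintype (H ⧸ Subgroup.center H)] (F : H → M)
    (hF : ∀ u, ∀ z ∈ Subgroup.center H, F (u * z) = F u) (v : H) :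
    ∑ g : H ⧸ Subgroup.center H, F (v * g.out) = ∑ g : H ⧸ Subgroup.center H, F g.out := by
  refine Fintype.sum_equiv (Equiv.mulLeft (v : H ⧸ Subgroup.center H)) _ _ fun g => ?_
  obtain ⟨z, hz⟩ := QuotientGroup.mk_out_eq_mul (Subgroup.center H) (v * g.out)
  have h : Equiv.mulLeft (v : H ⧸ Subgroup.center H) g = ((v * g.out : H) : H ⧸ _) := by
    simp
  rw [h, hz, hF _ _ z.2]

theorem coe_mem_center_of_mem_center
    (hspan : Submodule.span k ((fun u : Aˣ => (u : A)) '' U) = ⊤) {z : U}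
    (hz : z ∈ Subgroup.center U) : ((z : Aˣ) : A) ∈ Subring.center A := by
  refine mem_center_of_span hspan fun u hu => ?_
  have := Subgroup.mem_center_iff.1 hz ⟨u, hu⟩
  simpa using congrArg (fun w : U => ((w : Aˣ) : A)) this

variable [Fintype (U ⧸ Subgroup.center U)]

/-- The average of `x` over the conjugates by representatives of `U` modulo its center,
normalized by the central element `c`. -/
noncomputable def conjAverage (U : Subgroup Aˣ) [Fintype (U ⧸ Subgroup.center U)]
    (c : Subring.center A) : A →ₗ[Subring.center A] A :=
  c • ∑ g : U ⧸ Subgroup.center U,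
    (LinearMap.mulLeft (Subring.center A) ((g.out : Aˣ) : A)).comp
      (LinearMap.mulRight (Subring.center A) (((g.out : Aˣ)⁻¹ : Aˣ) : A))

theorem conjAverage_apply (c : Subring.center A) (x : A) :
    conjAverage U c x = c • ∑ g : U ⧸ Subgroup.center U,
      ((g.out : Aˣ) : A) * (x * (((g.out : Aˣ)⁻¹ : Aˣ) : A)) := by
  simp [conjAverage, LinearMap.sum_apply]

theorem commute_conjAverage
    (hspan : Submodule.span k ((fun u : Aˣ => (u : A)) '' U) = ⊤)
    (c : Subring.center A) (x : A) (v : U) :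
    ((v : Aˣ) : A) * conjAverage U c x = conjAverage U c x * ((v : Aˣ) : A) := by
  rw [conjAverage_apply, mul_smul_comm, smul_mul_assoc]
  congr 1
  have h := sum_out_mul (fun u : U => ((u : Aˣ) : A) * (x * (((u : Aˣ)⁻¹ : Aˣ) : A)))
    (fun u z hz => ?_) v
  · conv_rhs => rw [← h]
    rw [Finset.mul_sum, Finset.sum_mul]
    refine Finset.sum_congr rfl fun g _ => ?_
    simp [mul_assoc]
  · have hz' := Subring.mem_center_iff.1 (coe_mem_center_of_mem_center hspan hz)
    simp only [Subgroup.coe_mul, Units.val_mul, mul_inv_rev]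
    rw [mul_assoc, ← mul_assoc x, ← mul_assoc ((z : Aˣ) : A), ← hz', mul_assoc (x * _),
      mul_assoc x]
    simp

theorem conjAverage_mem_center
    (hspan : Submodule.span k ((fun u : Aˣ => (u : A)) '' U) = ⊤)
    (c : Subring.center A) (x : A) : conjAverage U c x ∈ Subring.center A :=
  mem_center_of_span hspan fun u hu => commute_conjAverage hspan c x ⟨u, hu⟩

theorem conjAverage_of_mem_center {c : Subring.center A}
    (hc : (c : A) * (Fintype.card (U ⧸ Subgroup.center U) : A) = 1) {x : A}
    (hx : x ∈ Subring.center A) : conjAverage U c x = x := by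
  have h : ∀ g : U ⧸ Subgroup.center U,
      ((g.out : Aˣ) : A) * (x * (((g.out : Aˣ)⁻¹ : Aˣ) : A)) = x := fun g => by
    rw [← mul_assoc, Subring.mem_center_iff.1 hx, Units.mul_inv_cancel_right]
  rw [conjAverage_apply, Finset.sum_congr rfl fun g _ => h g, Finset.sum_const,
    Finset.card_univ, nsmul_eq_mul, Subring.smul_def, smul_eq_mul, ← mul_assoc, hc, one_mul]

theorem conjAverage_of_notMem_center
    (hspan : Submodule.span k ((fun u : Aˣ => (u : A)) '' U) = ⊤)
    (hcomm : ∀ u ∈ U, ∀ v ∈ U, ∃ t : k, (v : A) * (u : A) = t • ((u : A) * (v : A)))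
    (c : Subring.center A) {u : U} (hu : u ∉ Subgroup.center U) :
    conjAverage U c ((u : Aˣ) : A) = 0 := by
  obtain ⟨v, hv⟩ : ∃ v : U, v * u ≠ u * v := by
    simpa [Subgroup.mem_center_iff] using hu
  have hs : ∃ s : A, ((v : Aˣ) : A) * s = s * ((v : Aˣ) : A) ∧
      conjAverage U c ((u : Aˣ) : A) = s * ((u : Aˣ) : A) := by
    choose t ht using fun w : U => hcomm u u.2 w w.2
    refine ⟨c * ∑ g : U ⧸ Subgroup.center U, algebraMap k A (t g.out), ?_, ?_⟩
    · rw [← map_sum, ← mul_assoc, Subring.mem_center_iff.1 c.2, mul_assoc, mul_assoc,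
        Algebra.commutes]
    · rw [conjAverage_apply, Subring.smul_def, smul_eq_mul, mul_assoc, Finset.sum_mul]
      congr 1
      refine Finset.sum_congr rfl fun g _ => ?_
      rw [← mul_assoc, ht, smul_mul_assoc, Units.mul_inv_cancel_right, Algebra.smul_def]
  obtain ⟨s, hsv, hs⟩ := hs
  obtain ⟨t, ht⟩ := hcomm u u.2 v v.2
  have h1 : t ≠ 1 := by
    rintro rfl
    refine hv (Subtype.ext (Units.ext ?_))
    simpa using ht
  have h2 := commute_conjAverage hspan c ((u : Aˣ) : A) v
  have h3 : ((v : Aˣ) : A) * conjAverage U c ((u : Aˣ) : A) =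
      t • (conjAverage U c ((u : Aˣ) : A) * ((v : Aˣ) : A)) := by
    rw [hs, ← mul_assoc, hsv, mul_assoc, ht, mul_smul_comm, mul_assoc]
  have h4 : (1 - t) • (conjAverage U c ((u : Aˣ) : A) * ((v : Aˣ) : A)) = 0 := by
    rw [sub_smul, one_smul, ← h3, h2, sub_self]
  have h5 := (smul_eq_zero_iff_right (sub_ne_zero.2 h1.symm)).1 h4
  exact (Units.mul_left_eq_zero _).1 h5

theorem sum_out_mul_conjAverage
    (hspan : Submodule.span k ((fun u : Aˣ => (u : A)) '' U) = ⊤)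
    (hcomm : ∀ u ∈ U, ∀ v ∈ U, ∃ t : k, (v : A) * (u : A) = t • ((u : A) * (v : A)))
    {c : Subring.center A}
    (hc : (c : A) * (Fintype.card (U ⧸ Subgroup.center U) : A) = 1) (x : A) :
    ∑ g : U ⧸ Subgroup.center U, ((g.out : Aˣ) : A) *
      conjAverage U c ((((g.out : Aˣ)⁻¹ : Aˣ) : A) * x) = x := by
  classical
  have hx : x ∈ Submodule.span k ((fun u : Aˣ => (u : A)) '' U) := hspan ▸ Submodule.mem_top
  induction hx using Submodule.span_induction with
  | mem x hx =>
    obtain ⟨v, hv, rfl⟩ := hx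
    rw [Fintype.sum_eq_single ((⟨v, hv⟩ : U) : U ⧸ Subgroup.center U)]
    · rw [conjAverage_of_mem_center hc, Units.mul_inv_cancel_left]
      have h : (((⟨v, hv⟩ : U) : U ⧸ Subgroup.center U).out)⁻¹ * ⟨v, hv⟩ ∈
          Subgroup.center U := QuotientGroup.eq.1 (by simp)
      simpa using coe_mem_center_of_mem_center hspan h
    · intro g hg
      have h : g.out⁻¹ * ⟨v, hv⟩ ∉ Subgroup.center U := fun h => hg <| by
        rw [← QuotientGroup.eq.2 h]; simp
      have := conjAverage_of_notMem_center hspan hcomm c h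
      simp only [Subgroup.coe_mul, Units.val_mul, Subgroup.coe_inv] at this
      rw [this, mul_zero]
  | zero => simp
  | add x y _ _ hx hy => simp only [mul_add, map_add, Finset.sum_add_distrib, hx, hy]
  | smul t x _ hx =>
    let z : Subring.center A := ⟨algebraMap k A t, Subring.mem_center_iff.2 fun a =>
      (Algebra.commutes t a).symm⟩
    have hz : ∀ a : A, t • a = z • a := fun a => by
      rw [Algebra.smul_def, Subring.smul_def, smul_eq_mul]
    simp only [hz, mul_smul_comm, map_smul, ← Finset.smul_sum, hx]

theorem sum_conjAverage_out_mul_inv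
    (hspan : Submodule.span k ((fun u : Aˣ => (u : A)) '' U) = ⊤)
    (hcomm : ∀ u ∈ U, ∀ v ∈ U, ∃ t : k, (v : A) * (u : A) = t • ((u : A) * (v : A)))
    {c : Subring.center A}
    (hc : (c : A) * (Fintype.card (U ⧸ Subgroup.center U) : A) = 1) :
    ∑ g : U ⧸ Subgroup.center U,
      conjAverage U c ((g.out : Aˣ) : A) * (((g.out : Aˣ)⁻¹ : Aˣ) : A) = 1 := by
  rw [Fintype.sum_eq_single 1]
  · have h : (1 : U ⧸ Subgroup.center U).out ∈ Subgroup.center U := by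
      rw [← QuotientGroup.eq_one_iff]; simp
    rw [conjAverage_of_mem_center hc (coe_mem_center_of_mem_center hspan h), Units.mul_inv]
  · intro g hg
    have h : g.out ∉ Subgroup.center U := fun h => hg <| by
      rw [← QuotientGroup.eq_one_iff] at h; simpa using h
    rw [conjAverage_of_notMem_center hspan hcomm c h, zero_mul]

theorem mulLeftRightMap_tmul (C : Type) [CommRing C] [Algebra C A] (a x : A) (b : Aᵐᵒᵖ) :
    mulLeftRightMap C A (a ⊗ₜ b) x = a * (x * b.unop) := by
  simp [mulLeftRightMap]

/-- The Casimir identity for the element `∑ u ⊗ u⁻¹`. -/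
theorem sum_mul_out_tmul
    (hspan : Submodule.span k ((fun u : Aˣ => (u : A)) '' U) = ⊤) (a b x y : A) :
    ∑ g : U ⧸ Subgroup.center U, (a * x * ((g.out : Aˣ) : A) * y) ⊗ₜ[Subring.center A]
        MulOpposite.op ((((g.out : Aˣ)⁻¹ : Aˣ) : A) * b) =
      ∑ g : U ⧸ Subgroup.center U, (a * ((g.out : Aˣ) : A) * y) ⊗ₜ[Subring.center A]
        MulOpposite.op ((((g.out : Aˣ)⁻¹ : Aˣ) : A) * x * b) := by
  have hx : x ∈ Submodule.span k ((fun u : Aˣ => (u : A)) '' U) := hspan ▸ Submodule.mem_top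
  induction hx using Submodule.span_induction with
  | mem x hx =>
    obtain ⟨v, hv, rfl⟩ := hx
    have h := sum_out_mul (fun u : U => (a * ((u : Aˣ) : A) * y) ⊗ₜ[Subring.center A]
      MulOpposite.op ((((u : Aˣ)⁻¹ : Aˣ) : A) * v * b)) (fun u z hz => ?_) ⟨v, hv⟩
    · rw [← h]
      refine Finset.sum_congr rfl fun g _ => ?_
      simp [mul_assoc]
    · have hz' := coe_mem_center_of_mem_center hspan hz
      have h1 : a * ((u * z : U) : Aˣ) * y =
          (⟨_, hz'⟩ : Subring.center A) • (a * ((u : Aˣ) : A) * y) := by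
        rw [Subring.smul_def, smul_eq_mul, Subgroup.coe_mul, Units.val_mul, ← mul_assoc a,
          Subring.mem_center_iff.1 hz', mul_assoc]
      have h2 : (⟨_, hz'⟩ : Subring.center A) • MulOpposite.op
          (((((u * z : U) : Aˣ)⁻¹ : Aˣ) : A) * v * b) =
          MulOpposite.op ((((u : Aˣ)⁻¹ : Aˣ) : A) * v * b) := by
        rw [← MulOpposite.op_smul, Subring.smul_def, smul_eq_mul]
        simp [mul_assoc]
      rw [h1, TensorProduct.smul_tmul, h2]
  | zero => simp
  | add x y _ _ hx hy =>
    simp only [mul_add, add_mul, TensorProduct.add_tmul, TensorProduct.tmul_add,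
      MulOpposite.op_add, Finset.sum_add_distrib, hx, hy]
  | smul t x _ hx =>
    let z : Subring.center A := ⟨algebraMap k A t, Subring.mem_center_iff.2 fun a =>
      (Algebra.commutes t a).symm⟩
    have hz : ∀ a : A, t • a = z • a := fun a => by
      rw [Algebra.smul_def, Subring.smul_def, smul_eq_mul]
    simp only [hz, mul_smul_comm, smul_mul_assoc, MulOpposite.op_smul,
      TensorProduct.tmul_smul, ← TensorProduct.smul_tmul', ← Finset.smul_sum, hx]

/-- If the `k`-algebra `A` is spanned by a group `U` of units that commute up to scalars and
the index of the center of `U` is finite and invertible, then `A` is Azumaya. -/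
theorem isAzumayaOverCenter_of_span_units
    (hspan : Submodule.span k ((fun u : Aˣ => (u : A)) '' U) = ⊤)
    (hcomm : ∀ u ∈ U, ∀ v ∈ U, ∃ t : k, (v : A) * (u : A) = t • ((u : A) * (v : A)))
    (hcard : (Fintype.card (U ⧸ Subgroup.center U) : k) ≠ 0) : IsAzumayaOverCenter A := by
  obtain ⟨c, hc⟩ : ∃ c : Subring.center A,
      (c : A) * (Fintype.card (U ⧸ Subgroup.center U) : A) = 1 := by
    refine ⟨⟨algebraMap k A (Fintype.card (U ⧸ Subgroup.center U) : k)⁻¹,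
      Subring.mem_center_iff.2 fun a => (Algebra.commutes _ a).symm⟩, ?_⟩
    rw [← map_natCast (algebraMap k A), ← map_mul, inv_mul_cancel₀ hcard, map_one]
  let p : A →ₗ[Subring.center A] Subring.center A :=
    { toFun := fun x => ⟨conjAverage U c x, conjAverage_mem_center hspan c x⟩
      map_add' := fun x y => Subtype.ext (map_add _ x y)
      map_smul' := fun z x => Subtype.ext (map_smul _ z x) }
  have hp : ∀ x y : A, p x • y = y * conjAverage U c x := fun x y => by
    rw [Subring.smul_def, smul_eq_mul]
    exact (Subring.mem_center_iff.1 (conjAverage_mem_center hspan c x) y).symm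
  let i : A →ₗ[Subring.center A] (U ⧸ Subgroup.center U → Subring.center A) :=
    LinearMap.pi fun g => p.comp
      (LinearMap.mulLeft (Subring.center A) (((g.out : Aˣ)⁻¹ : Aˣ) : A))
  let s : (U ⧸ Subgroup.center U → Subring.center A) →ₗ[Subring.center A] A :=
    Fintype.linearCombination (Subring.center A) fun g => ((g.out : Aˣ) : A)
  have hdual : ∀ x : A, ∑ g : U ⧸ Subgroup.center U,
      p ((((g.out : Aˣ)⁻¹ : Aˣ) : A) * x) • ((g.out : Aˣ) : A) = x := fun x => by
    simp only [hp]
    exact sum_out_mul_conjAverage hspan hcomm hc x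
  have hsi : s.comp i = LinearMap.id := LinearMap.ext fun x => by
    simpa [s, i, Fintype.linearCombination_apply] using hdual x
  refine ⟨Module.Finite.of_surjective s fun x => ⟨i x, LinearMap.congr_fun hsi x⟩,
    Module.Projective.of_split i s hsi, ⟨fun h => ?_⟩, ?_⟩
  · have := h (1 : A)
    simpa [Subring.smul_def] using this
  let r : Module.End (Subring.center A) A → A ⊗[Subring.center A] Aᵐᵒᵖ := fun f =>
    c • ∑ g : U ⧸ Subgroup.center U, ∑ w : U ⧸ Subgroup.center U,
      (f ((g.out : Aˣ) : A) * ((w.out : Aˣ) : A) * (((g.out : Aˣ)⁻¹ : Aˣ) : A))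
        ⊗ₜ[Subring.center A] MulOpposite.op (((w.out : Aˣ)⁻¹ : Aˣ) : A)
  have hr : ∀ f f', r (f + f') = r f + r f' := fun f f' => by
    simp only [r, LinearMap.add_apply, add_mul, TensorProduct.add_tmul,
      Finset.sum_add_distrib, smul_add]
  refine ⟨Function.LeftInverse.injective (g := r) fun t => ?_, fun f => ⟨r f, ?_⟩⟩
  · induction t using TensorProduct.induction_on with
    | zero => simp [r]
    | add t t' ht ht' => rw [map_add, hr, ht, ht']
    | tmul a b =>
      induction b using MulOpposite.rec' with | _ b
      have h1 : ∀ g : U ⧸ Subgroup.center U, ∑ w : U ⧸ Subgroup.center U,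
          (a * (((g.out : Aˣ) : A) * b) * ((w.out : Aˣ) : A) * (((g.out : Aˣ)⁻¹ : Aˣ) : A))
            ⊗ₜ[Subring.center A] MulOpposite.op (((w.out : Aˣ)⁻¹ : Aˣ) : A) =
          ∑ w : U ⧸ Subgroup.center U,
          (a * (((g.out : Aˣ) : A) * (((w.out : Aˣ) : A) * (((g.out : Aˣ)⁻¹ : Aˣ) : A))))
            ⊗ₜ[Subring.center A] MulOpposite.op ((((w.out : Aˣ)⁻¹ : Aˣ) : A) * b) := by
        intro g
        simpa [mul_assoc] using
          sum_mul_out_tmul hspan (a * ((g.out : Aˣ) : A)) 1 b (((g.out : Aˣ)⁻¹ : Aˣ) : A)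
      have h2 : ∀ w : U ⧸ Subgroup.center U, c • ∑ g : U ⧸ Subgroup.center U,
          (a * (((g.out : Aˣ) : A) * (((w.out : Aˣ) : A) * (((g.out : Aˣ)⁻¹ : Aˣ) : A))))
            ⊗ₜ[Subring.center A] MulOpposite.op ((((w.out : Aˣ)⁻¹ : Aˣ) : A) * b) =
          a ⊗ₜ MulOpposite.op
            (conjAverage U c ((w.out : Aˣ) : A) * (((w.out : Aˣ)⁻¹ : Aˣ) : A) * b) := by
        intro w
        rw [← TensorProduct.sum_tmul, ← Finset.mul_sum, TensorProduct.smul_tmul',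
          ← mul_smul_comm, ← conjAverage_apply, ← hp, TensorProduct.smul_tmul,
          ← MulOpposite.op_smul, mul_assoc]
        rfl
      simp only [r, mulLeftRightMap_tmul, MulOpposite.unop_op]
      rw [Finset.sum_congr rfl fun g _ => h1 g, Finset.sum_comm, Finset.smul_sum,
        Finset.sum_congr rfl fun w _ => h2 w, ← TensorProduct.tmul_sum, ← Finset.op_sum,
        ← Finset.sum_mul, sum_conjAverage_out_mul_inv hspan hcomm hc, one_mul]
  · ext x
    conv_rhs => rw [← hdual x, map_sum]
    simp only [r, map_smul, map_sum, LinearMap.smul_apply, LinearMap.sum_apply,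
      mulLeftRightMap_tmul, MulOpposite.unop_op, Finset.smul_sum]
    simp only [hp]
    refine Finset.sum_congr rfl fun g _ => ?_
    rw [conjAverage_apply, mul_smul_comm, Finset.mul_sum, Finset.smul_sum]
    simp only [mul_assoc]

end SpanningUnits

theorem exists_pow_eq_one_of_mem_closure {k A : Type} [Field k] [Ring A] [Algebra k A] {q : k}
    {m : ℕ} (hq : IsPrimitiveRoot q m) {S : Set Aˣ}
    (hS : ∀ x ∈ S, ∀ y ∈ S, ∃ j : ℤ, (y : A) * x = q ^ j • ((x : A) * y)) (hm : 0 < m)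
    {u v : Aˣ} (hu : u ∈ Subgroup.closure S) (hv : v ∈ Subgroup.closure S) :
    ∃ t : k, t ^ m = 1 ∧ (v : A) * u = t • ((u : A) * v) := by
  let ζ : kˣ := hq.isUnit hm.ne' |>.unit
  let z : Aˣ := Units.map (algebraMap k A).toMonoidHom ζ
  have hz : ∀ (j : ℤ) (a : A), ((z ^ j : Aˣ) : A) * a = q ^ j • a := fun j a => by
    rw [← map_zpow, Algebra.smul_def]
    change algebraMap k A ((ζ ^ j : kˣ) : k) * a = _
    rw [Units.val_zpow_eq_zpow_val]
    rfl
  have hzc : ∀ (j : ℤ) (a : Aˣ), z ^ j * a = a * z ^ j := fun j a => Units.ext <| by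
    rw [← map_zpow]
    exact Algebra.commutes _ _
  let C := Subgroup.zpowers z
  have hC : C.Normal := ⟨fun w hw g => by
    obtain ⟨j, rfl⟩ := hw
    exact ⟨j, by simp [← hzc]⟩⟩
  have h : Commute (v : Aˣ ⧸ C) (u : Aˣ ⧸ C) := by
    induction hu, hv using Subgroup.closure_induction₂ with
    | mem x y hx hy =>
      obtain ⟨j, hj⟩ := hS x hx y hy
      refine (QuotientGroup.eq.2 ⟨-j, ?_⟩ : ((y * x : Aˣ) : Aˣ ⧸ C) = ((x * y : Aˣ) : Aˣ ⧸ C))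
      have : y * x = z ^ j * (x * y) := Units.ext <| by
        rw [Units.val_mul _ (x * y), hz]; simpa using hj
      rw [this]
      simp [hzc, ← mul_assoc]
    | one_left x _ => exact Commute.one_right _
    | one_right x _ => exact Commute.one_left _
    | mul_left x y w _ _ _ h1 h2 => exact Commute.mul_right h1 h2
    | mul_right y w x _ _ _ h1 h2 => exact Commute.mul_left h1 h2
    | inv_left x y _ _ h => exact Commute.inv_right h
    | inv_right x y _ _ h => exact Commute.inv_left h
  obtain ⟨j, hj⟩ := QuotientGroup.eq.1
    (h.eq.symm : ((u * v : Aˣ) : Aˣ ⧸ C) = ((v * u : Aˣ) : Aˣ ⧸ C))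
  refine ⟨q ^ j, by rw [← zpow_natCast, zpow_comm, zpow_natCast, hq.pow_eq_one, one_zpow], ?_⟩
  have : v * u = z ^ j * (u * v) := by
    rw [hzc, show z ^ j = _ from hj, mul_inv_cancel_left]
  simpa [hz] using congrArg (fun w : Aˣ => (w : A)) this

theorem isAzumayaOverCenter_of_adjoin_eq_top {k A ι : Type} [Field k] [Ring A] [Algebra k A]
    [Finite ι] {q : k} {m : ℕ} (hm : 0 < m) (hq : IsPrimitiveRoot q m) (X : ι → Aˣ)
    (hX : ∀ i j, ∃ l : ℤ, (X j : A) * X i = q ^ l • ((X i : A) * X j))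
    (htop : Algebra.adjoin k
      (Set.range (fun i => (X i : A)) ∪ Set.range fun i => (((X i)⁻¹ : Aˣ) : A)) = ⊤) :
    IsAzumayaOverCenter A := by
  let U : Subgroup Aˣ := Subgroup.closure (Set.range X)
  have hXU : ∀ i, X i ∈ U := fun i => Subgroup.subset_closure ⟨i, rfl⟩
  have hU : ∀ u ∈ U, ∀ v ∈ U, ∃ t : k, t ^ m = 1 ∧ (v : A) * (u : A) = t • ((u : A) * v) := by
    intro u hu v hv
    refine exists_pow_eq_one_of_mem_closure hq ?_ hm hu hv
    rintro _ ⟨i, rfl⟩ _ ⟨j, rfl⟩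
    exact hX i j
  have hspan : Submodule.span k ((fun u : Aˣ => (u : A)) '' U) = ⊤ := by
    rw [eq_top_iff, ← Algebra.top_toSubmodule, ← htop, Algebra.adjoin_eq_span]
    refine Submodule.span_mono ?_
    change ((Submonoid.closure _ : Submonoid A) : Set A) ⊆ U.toSubmonoid.map (Units.coeHom A)
    refine Submonoid.closure_le.2 (Set.union_subset ?_ ?_)
    · rintro _ ⟨i, rfl⟩; exact ⟨X i, hXU i, rfl⟩
    · rintro _ ⟨i, rfl⟩; exact ⟨(X i)⁻¹, U.inv_mem (hXU i), rfl⟩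
  have hcen : ∀ w : U, (∀ i, (w : Aˣ) * X i = X i * w) → w ∈ Subgroup.center U := by
    intro w hw
    have : U ≤ Subgroup.centralizer {(w : Aˣ)} := (Subgroup.closure_le _).2 <| by
      rintro _ ⟨i, rfl⟩
      simpa [Subgroup.mem_centralizer_iff] using hw i
    refine Subgroup.mem_center_iff.2 fun v => Subtype.ext ?_
    exact (Subgroup.mem_centralizer_iff.1 (this v.2) w rfl).symm
  have hconj : ∀ (u : U) (i : ι), ((u : Aˣ) : A) * (X i : A) * (((u : Aˣ)⁻¹ : Aˣ) : A) ∈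
      (fun t : k => t • (X i : A)) '' (Polynomial.nthRootsFinset m (1 : k) : Set k) := by
    intro u i
    obtain ⟨t, ht, h⟩ := hU _ (hXU i) u u.2
    refine ⟨t, (Polynomial.mem_nthRootsFinset hm 1).2 ht, ?_⟩
    simp only [h, smul_mul_assoc, Units.mul_inv_cancel_right]
  have hfin : Finite (U ⧸ Subgroup.center U) := by
    have : ∀ i, Finite
        ((fun t : k => t • (X i : A)) '' (Polynomial.nthRootsFinset m (1 : k) : Set k)) :=
      fun i => ((Finset.finite_toSet _).image _).to_subtype
    refine Finite.of_injective (fun (g : U ⧸ Subgroup.center U) (i : ι) =>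
      (⟨_, hconj g.out i⟩ :
        (fun t : k => t • (X i : A)) '' (Polynomial.nthRootsFinset m (1 : k) : Set k))) ?_
    intro g g' hg
    rw [← QuotientGroup.out_eq' g, ← QuotientGroup.out_eq' g']
    refine QuotientGroup.eq.2 (hcen _ fun i => ?_)
    have h : (g.out : Aˣ) * X i * (g.out : Aˣ)⁻¹ = (g'.out : Aˣ) * X i * (g'.out : Aˣ)⁻¹ :=
      Units.ext (congrArg Subtype.val (congrFun hg i))
    rw [mul_inv_eq_iff_eq_mul] at h
    simp only [Subgroup.coe_mul, Subgroup.coe_inv]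
    rw [mul_assoc, inv_mul_eq_iff_eq_mul, ← mul_assoc, ← mul_assoc, h]
    group
  have := Fintype.ofFinite (U ⧸ Subgroup.center U)
  refine isAzumayaOverCenter_of_span_units hspan
    (fun u hu v hv => (hU u hu v hv).imp fun t ht => ht.2) fun h0 => ?_
  obtain ⟨p, hchar⟩ := CharP.exists k
  have hdvd := (CharP.cast_eq_zero_iff k p _).1 h0
  have hp : p.Prime := (CharP.char_is_prime_or_zero k p).resolve_right fun h =>
    Fintype.card_ne_zero (Nat.eq_zero_of_zero_dvd (h ▸ hdvd))
  have := Fact.mk hp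
  obtain ⟨g, hg⟩ := exists_prime_orderOf_dvd_card p hdvd
  have hgm : g ^ m = 1 := by
    rw [← QuotientGroup.out_eq' g]
    refine (QuotientGroup.eq_one_iff (g.out ^ m)).2 (hcen _ fun i => Units.ext ?_)
    obtain ⟨t, ht, h⟩ := hU _ (hXU i) g.out g.out.2
    have hpow : ∀ l : ℕ, (((g.out : Aˣ) : A) ^ l) * X i =
        t ^ l • ((X i : A) * ((g.out : Aˣ) : A) ^ l) := by
      intro l
      induction l with
      | zero => simp
      | succ l ih =>
        rw [pow_succ, mul_assoc, h, mul_smul_comm, ← mul_assoc, ih, smul_mul_assoc, smul_smul,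
          mul_assoc, pow_succ' t]
    simpa [ht] using hpow m
  have hm0 : (m : k) = 0 := (CharP.cast_eq_zero_iff k p m).2 (hg ▸ orderOf_dvd_of_pow_eq_one hgm)
  have := NeZero.of_pos hm
  exact hq.neZero'.out hm0

/-- Let `k` be a field, `q ∈ k` a primitive `m`-th root of unity and
`J = (h i j)` a skew-symmetric integer `n × n` matrix.  The quasipolynomial Laurent
algebra `k_J[x_1^{±1}, ..., x_n^{±1}]` is an Azumaya algebra over its center. -/
theorem qLaurent_isAzumayaOverCenter
    (k : Type) [Field k] (q : k) (m : ℕ) (hm : 0 < m) (hq : IsPrimitiveRoot q m)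
    (n : ℕ) (h : Fin n → Fin n → ℤ) (hskew : ∀ i j, h j i = - h i j) :
    IsAzumayaOverCenter (QLaurent k q n h) := by
  let a : FreeAlgebra k (Fin n ⊕ Fin n) →ₐ[k] QLaurent k q n h := RingQuot.mkAlgHom k _
  have ha : ∀ {x y}, QLaurentRel k q n h x y → a x = a y := fun hxy =>
    RingQuot.mkAlgHom_rel k hxy
  let X : Fin n → (QLaurent k q n h)ˣ := fun i =>
    { val := a (FreeAlgebra.ι k (Sum.inl i))
      inv := a (FreeAlgebra.ι k (Sum.inr i))
      val_inv := by rw [← map_mul, ha (.mul_inv i), map_one]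
      inv_val := by rw [← map_mul, ha (.inv_mul i), map_one] }
  have hlt : ∀ i j, i < j → (X i : QLaurent k q n h) * X j = q ^ h i j • ((X j : _) * X i) :=
    fun i j hij => by simpa only [map_mul, map_smul] using ha (.comm i j hij)
  refine isAzumayaOverCenter_of_adjoin_eq_top hm hq X (fun i j => ?_) ?_
  · rcases lt_trichotomy i j with hij | rfl | hij
    · refine ⟨-h i j, ?_⟩
      rw [hlt i j hij, smul_smul, ← zpow_add₀ (hq.isUnit hm.ne').ne_zero, neg_add_cancel,
        zpow_zero, one_smul]
    · exact ⟨0, by simp⟩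
    · exact ⟨h j i, hlt j i hij⟩
  · rw [eq_top_iff, ← (AlgHom.range_eq_top a).2 (RingQuot.mkAlgHom_surjective k _),
      ← Algebra.map_top, ← FreeAlgebra.adjoin_range_ι, AlgHom.map_adjoin]
    refine Algebra.adjoin_mono ?_
    rintro _ ⟨_, ⟨i | i, rfl⟩, rfl⟩
    · exact Or.inl ⟨i, rfl⟩
    · exact Or.inr ⟨i, rfl⟩
end
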